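/- arXiv:2004.08721 — 3 statements merged into one kernel-verified Lean document; each statement's English description precedes it below -/
import Mathlib

section
/- For integers k ≥ 2 and n with 2k ≤ n ≤ k², one has g(n,k,1) = k·C(n−1,k). -/
/-- `v` is a `{0,1,-1}`-vector of length `n` with exactly `k` coordinates equal to `+1`
and exactly `l` coordinates equal to `-1`, i.e. `v ∈ V(n,k,l)`. -/
def IsPMVec (n k l : ℕ) (v : Fin n → ℤ) : Prop :=
  (∀ i, v i = 0 ∨ v i = 1 ∨ v i = -1) ∧
  (Finset.univ.filter fun i => v i = 1).card = k ∧
  (Finset.univ.filter fun i => v i = -1).card = l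

/-- the standard scalar product -/
def dotZ {n : ℕ} (v w : Fin n → ℤ) : ℤ := ∑ i, v i * w i

/-- `g(n,k,l)`: the maximum size of a family `V ⊆ V(n,k,l)` with
`⟨v,w⟩ > -2l` for all `v, w ∈ V`. -/
noncomputable def gVal (n k l : ℕ) : ℕ :=
  sSup {m | ∃ F : Finset (Fin n → ℤ),
    (∀ v ∈ F, IsPMVec n k l v) ∧
    (∀ v ∈ F, ∀ w ∈ F, -2 * (l : ℤ) < dotZ v w) ∧ F.card = m}

open Finset

/-- The sum of `I` and the interval `{0, …, L}` in `ZMod M`. -/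
def addInterval {M : ℕ} (I : Finset (ZMod M)) (L : ℕ) : Finset (ZMod M) :=
  (range (L + 1)).biUnion fun d => I.image fun i => i + (d : ZMod M)

lemma mem_addInterval {M : ℕ} {I : Finset (ZMod M)} {L : ℕ} {x : ZMod M} :
    x ∈ addInterval I L ↔ ∃ d ≤ L, ∃ i ∈ I, i + (d : ZMod M) = x := by
  simp only [addInterval, mem_biUnion, mem_range, Nat.lt_succ_iff, mem_image]

lemma min_le_card_addInterval {M : ℕ} [NeZero M] {I : Finset (ZMod M)} (hI : I.Nonempty) (L : ℕ) :
    min M (#I + L) ≤ #(addInterval I L) := by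
  induction L with
  | zero =>
    refine (min_le_right _ _).trans (card_le_card fun i hi => mem_addInterval.2 ⟨0, le_rfl, i, hi, ?_⟩)
    simp
  | succ L ih =>
    have hsub : addInterval I L ⊆ addInterval I (L + 1) := fun x hx => by
      obtain ⟨d, hd, h⟩ := mem_addInterval.1 hx
      exact mem_addInterval.2 ⟨d, by omega, h⟩
    by_cases heq : addInterval I (L + 1) ⊆ addInterval I L
    · have hstep : ∀ x ∈ addInterval I L, x + 1 ∈ addInterval I L := fun x hx => by
        obtain ⟨d, hd, i, hi, rfl⟩ := mem_addInterval.1 hx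
        exact heq (mem_addInterval.2 ⟨d + 1, by omega, i, hi, by push_cast; ring⟩)
      have hall : ∀ t : ℕ, ∀ x ∈ addInterval I L, x + (t : ZMod M) ∈ addInterval I L := by
        intro t
        induction t with
        | zero => simp
        | succ t iht =>
          intro x hx
          have := hstep _ (iht x hx)
          push_cast
          rwa [← add_assoc]
      have huniv : addInterval I L = univ := by
        obtain ⟨i, hi⟩ := hI
        refine eq_univ_iff_forall.2 fun z => ?_
        have := hall (z - i).val i (hsub.antisymm heq ▸ mem_addInterval.2 ⟨0, by omega, i, hi, by simp⟩)
        rwa [ZMod.natCast_zmod_val, add_sub_cancel] at this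
      have := card_le_card hsub
      rw [huniv, card_univ, ZMod.card] at this
      exact (min_le_left _ _).trans this
    · have := card_lt_card (Finset.ssubset_iff_subset_ne.2 ⟨hsub, fun h => heq h.ge⟩)
      omega

/-- The arc `{i, i + 1, …, i + a - 1}` of the circle `ZMod M`. -/
def arc {M : ℕ} (i : ZMod M) (a : ℕ) : Finset (ZMod M) :=
  (range a).image fun t : ℕ => i + (t : ZMod M)

lemma mem_arc {M : ℕ} {i x : ZMod M} {a : ℕ} :
    x ∈ arc i a ↔ ∃ t < a, i + (t : ZMod M) = x := by
  simp only [arc, mem_image, mem_range]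

lemma natCast_zmod_inj_of_lt {M s t : ℕ} (hs : s < M) (ht : t < M)
    (h : (s : ZMod M) = t) : s = t := by
  have := (ZMod.natCast_eq_natCast_iff s t M).1 h
  rwa [Nat.ModEq, Nat.mod_eq_of_lt hs, Nat.mod_eq_of_lt ht] at this

lemma card_arc {M : ℕ} (i : ZMod M) {a : ℕ} (ha : a ≤ M) : #(arc i a) = a := by
  rw [arc, card_image_of_injOn, card_range]
  intro s hs t ht h
  simp only [coe_range, Set.mem_Iio] at hs ht
  exact natCast_zmod_inj_of_lt (by omega) (by omega) (add_left_cancel h)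

lemma disjoint_arc {M : ℕ} (i : ZMod M) {a b d : ℕ} (had : a ≤ d) (hdb : d + b ≤ M) :
    Disjoint (arc i a) (arc (i + (d : ZMod M)) b) := by
  rw [disjoint_left]
  intro x hx hx'
  obtain ⟨t, ht, rfl⟩ := mem_arc.1 hx
  obtain ⟨s, hs, h⟩ := mem_arc.1 hx'
  rw [add_assoc] at h
  have h' : ((d + s : ℕ) : ZMod M) = t := by push_cast; exact add_left_cancel h
  have := natCast_zmod_inj_of_lt (by omega) (by omega) h'
  omega

lemma arc_subset_arc {M : ℕ} (i : ZMod M) {a b d : ℕ} (h : d + b ≤ a) :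
    arc (i + (d : ZMod M)) b ⊆ arc i a := by
  intro x hx
  obtain ⟨s, hs, rfl⟩ := mem_arc.1 hx
  exact mem_arc.2 ⟨d + s, by omega, by push_cast; ring⟩

/-- Katona's bound on a single circle, for arcs starting in `I` and `J`. -/
lemma circle_bound {M a b : ℕ} [NeZero M] (hba : b ≤ a) (hab : a + b ≤ M)
    (I J : Finset (ZMod M))
    (hsub : ∀ i ∈ I, ∀ d ≤ a - b, i + (d : ZMod M) ∈ J)
    (hdis : ∀ i ∈ I, ∀ d, a ≤ d → d + b ≤ M → i + (d : ZMod M) ∉ J) :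
    b * #J + (M - a) * #I ≤ b * M := by
  rcases I.eq_empty_or_nonempty with rfl | hI
  · simpa using Nat.mul_le_mul_left b ((card_le_univ J).trans_eq (ZMod.card M))
  have hG : addInterval I (a - b) ⊆ J := fun x hx => by
    obtain ⟨d, hd, i, hi, rfl⟩ := mem_addInterval.1 hx
    exact hsub i hi d hd
  have hH : (addInterval I (M - a - b)).image (fun x => x + (a : ZMod M)) ⊆ Jᶜ := fun x hx => by
    obtain ⟨y, hy, rfl⟩ := mem_image.1 hx
    obtain ⟨d, hd, i, hi, rfl⟩ := mem_addInterval.1 hy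
    have := hdis i hi (d + a) (by omega) (by omega)
    rw [mem_compl]
    push_cast at this
    rwa [add_assoc]
  have hG' := card_le_card hG
  have hH' := card_le_card hH
  rw [card_image_of_injective _ (add_left_injective _), card_compl, ZMod.card] at hH'
  have h1 := min_le_card_addInterval hI (a - b)
  have h2 := min_le_card_addInterval hI (M - a - b)
  have hJ : #J ≤ M := (card_le_univ J).trans_eq (ZMod.card M)
  have hIpos := hI.card_pos
  have hM := NeZero.pos M
  have hJs : #J + #I ≤ a + b := by omega
  have hIb : #I ≤ b := by omega
  obtain ⟨c, rfl⟩ := Nat.exists_eq_add_of_le hab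
  have : a + b + c - a = b + c := by omega
  rw [this]
  nlinarith [Nat.mul_le_mul_left b hJs, Nat.mul_le_mul_left c hIb]

section Averaging

variable {α : Type*} [Fintype α] [DecidableEq α]

lemma exists_perm_map_eq {s t : Finset α} (h : #s = #t) :
    ∃ τ : Equiv.Perm α, s.map τ.toEmbedding = t := by
  let e : {x // x ∈ s} ≃ {x // x ∈ t} := Finset.equivOfCardEq h
  refine ⟨e.extendSubtype, eq_of_subset_of_card_le ?_ (by simp [h])⟩
  intro x hx
  obtain ⟨y, hy, rfl⟩ := mem_map.1 hx
  exact e.extendSubtype_mem y hy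

lemma card_perm_map_eq_mul_choose {s t : Finset α} (h : #s = #t) :
    #{π : Equiv.Perm α | s.map π.toEmbedding = t} * (Fintype.card α).choose #s
      = (Fintype.card α).factorial := by
  have hsum : ∑ u ∈ powersetCard #s (univ : Finset α),
      #{π : Equiv.Perm α | s.map π.toEmbedding = u} = (Fintype.card α).factorial := by
    rw [← Fintype.card_perm, ← card_univ]
    refine (card_eq_sum_card_fiberwise fun π _ => ?_).symm
    simp [mem_powersetCard]
  rw [← hsum, sum_const_nat (m := #{π : Equiv.Perm α | s.map π.toEmbedding = t}),
    card_powersetCard, card_univ, mul_comm]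
  intro u hu
  obtain ⟨τ, hτ⟩ := exists_perm_map_eq (h.symm.trans (mem_powersetCard.1 hu).2.symm)
  refine (card_bij (fun π _ => π.trans τ) ?_ ?_ ?_).symm
  · intro π hπ
    simp only [mem_filter, mem_univ, true_and] at hπ ⊢
    rw [← hτ, ← hπ, map_map]
    rfl
  · intro π _ ρ _ h
    ext x
    simpa using congrArg (fun σ : Equiv.Perm α => σ x) h
  · intro π hπ
    refine ⟨π.trans τ.symm, ?_, by ext; simp⟩
    simp only [mem_filter, mem_univ, true_and] at hπ ⊢
    apply map_injective τ.toEmbedding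
    rw [hτ, ← hπ, map_map]
    congr 1
    ext x
    simp

lemma card_perm_map_mem_mul_choose {s : Finset α} {𝒳 : Finset (Finset α)}
    (h : ∀ t ∈ 𝒳, #t = #s) :
    #{π : Equiv.Perm α | s.map π.toEmbedding ∈ 𝒳} * (Fintype.card α).choose #s
      = #𝒳 * (Fintype.card α).factorial := by
  have : #{π : Equiv.Perm α | s.map π.toEmbedding ∈ 𝒳}
      = ∑ t ∈ 𝒳, #{π : Equiv.Perm α | s.map π.toEmbedding = t} := by
    rw [card_eq_sum_card_fiberwise (f := fun π : Equiv.Perm α => s.map π.toEmbedding) (t := 𝒳)]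
    · refine sum_congr rfl fun t ht => ?_
      congr 1
      ext π
      simp only [mem_filter, mem_univ, true_and]
      exact ⟨fun h => h.2, fun h => ⟨h ▸ ht, h⟩⟩
    · intro π hπ
      simpa using hπ
  rw [this, sum_mul, sum_const_nat]
  intro t ht
  exact card_perm_map_eq_mul_choose (h t ht).symm

end Averaging

lemma sum_card_arc_mem {M a : ℕ} [NeZero M] (ha : a ≤ M) {𝒳 : Finset (Finset (ZMod M))}
    (h𝒳 : ∀ X ∈ 𝒳, #X = a) :
    (∑ π : Equiv.Perm (ZMod M), #{i | (arc i a).map π.toEmbedding ∈ 𝒳}) * M.choose a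
      = M * (#𝒳 * M.factorial) := by
  simp_rw [card_filter]
  rw [sum_comm, sum_mul, sum_const_nat (m := #𝒳 * M.factorial), card_univ, ZMod.card]
  intro i _
  have := card_perm_map_mem_mul_choose (s := arc i a) (𝒳 := 𝒳)
    (fun X hX => (h𝒳 X hX).trans (card_arc i ha).symm)
  rw [card_arc i ha, ZMod.card] at this
  rw [← this, card_filter]

lemma cross_bound_zmod {M a b : ℕ} [NeZero M] (hba : b ≤ a) (hab : a + b ≤ M)
    {𝒳 𝒴 : Finset (Finset (ZMod M))} (h𝒳 : ∀ X ∈ 𝒳, #X = a) (h𝒴 : ∀ Y ∈ 𝒴, #Y = b)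
    (hsub : ∀ X ∈ 𝒳, ∀ Y ⊆ X, #Y = b → Y ∈ 𝒴)
    (hcross : ∀ X ∈ 𝒳, ∀ Y ∈ 𝒴, ¬ Disjoint X Y) :
    b * #𝒴 * M.choose a + (M - a) * #𝒳 * M.choose b ≤ b * M.choose a * M.choose b := by
  have key : ∀ π : Equiv.Perm (ZMod M),
      b * #{i | (arc i b).map π.toEmbedding ∈ 𝒴}
        + (M - a) * #{i | (arc i a).map π.toEmbedding ∈ 𝒳} ≤ b * M := by
    intro π
    refine circle_bound hba hab _ _ ?_ ?_
    · intro i hi d hd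
      simp only [mem_filter, mem_univ, true_and] at hi ⊢
      refine hsub _ hi _ (map_subset_map.2 (arc_subset_arc i (by omega))) ?_
      rw [card_map, card_arc _ (by omega)]
    · intro i hi d had hdb hJ
      simp only [mem_filter, mem_univ, true_and] at hi hJ
      exact hcross _ hi _ hJ ((disjoint_map _).2 (disjoint_arc i had hdb))
  have hsum := sum_le_sum fun π (_ : π ∈ (univ : Finset (Equiv.Perm (ZMod M)))) => key π
  rw [sum_add_distrib, ← mul_sum, ← mul_sum, sum_const, card_univ, Fintype.card_perm, ZMod.card,
    smul_eq_mul] at hsum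
  have hX := sum_card_arc_mem (M := M) (by omega) h𝒳
  have hY := sum_card_arc_mem (M := M) (by omega) h𝒴
  have hMpos : 0 < M * M.factorial := Nat.mul_pos (NeZero.pos M) (Nat.factorial_pos M)
  refine Nat.le_of_mul_le_mul_left ?_ hMpos
  have := Nat.mul_le_mul_right (M.choose a * M.choose b) hsum
  set SX := ∑ π : Equiv.Perm (ZMod M), #{i | (arc i a).map π.toEmbedding ∈ 𝒳}
  set SY := ∑ π : Equiv.Perm (ZMod M), #{i | (arc i b).map π.toEmbedding ∈ 𝒴}
  calc M * M.factorial * (b * #𝒴 * M.choose a + (M - a) * #𝒳 * M.choose b)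
      = b * M.choose a * (M * (#𝒴 * M.factorial))
        + (M - a) * M.choose b * (M * (#𝒳 * M.factorial)) := by ring
    _ = (b * SY + (M - a) * SX) * (M.choose a * M.choose b) := by rw [← hX, ← hY]; ring
    _ ≤ _ := this
    _ = _ := by ring

/-- A weighted bound for cross-intersecting families of `a`-sets and `b`-sets. -/
lemma cross_bound {α : Type*} [DecidableEq α] {S : Finset α} {a b : ℕ} (hS : S.Nonempty)
    (hba : b ≤ a) (hab : a + b ≤ #S)
    {𝒳 𝒴 : Finset (Finset α)} (h𝒳 : ∀ X ∈ 𝒳, X ⊆ S ∧ #X = a) (h𝒴 : ∀ Y ∈ 𝒴, Y ⊆ S ∧ #Y = b)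
    (hsub : ∀ X ∈ 𝒳, ∀ Y ⊆ X, #Y = b → Y ∈ 𝒴)
    (hcross : ∀ X ∈ 𝒳, ∀ Y ∈ 𝒴, ¬ Disjoint X Y) :
    b * #𝒴 * (#S).choose a + (#S - a) * #𝒳 * (#S).choose b
      ≤ b * (#S).choose a * (#S).choose b := by
  have : NeZero #S := ⟨hS.card_pos.ne'⟩
  let e : S ≃ ZMod #S := Fintype.equivOfCardEq (by simp)
  let ι : ZMod #S ↪ α := e.symm.toEmbedding.trans (Function.Embedding.subtype _)
  have hι : ∀ X ⊆ S, ∃ Z : Finset (ZMod #S), Z.map ι = X := by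
    intro X hX
    refine ⟨univ.filter fun z => ι z ∈ X, ?_⟩
    ext x
    simp only [mem_map, mem_filter, mem_univ, true_and]
    refine ⟨by rintro ⟨z, hz, rfl⟩; exact hz, fun hx => ⟨e ⟨x, hX hx⟩, ?_, ?_⟩⟩ <;> simp [ι, hx]
  let pull (𝒵 : Finset (Finset α)) : Finset (Finset (ZMod #S)) := univ.filter fun Z => Z.map ι ∈ 𝒵
  have mem_pull : ∀ 𝒵 Z, Z ∈ pull 𝒵 ↔ Z.map ι ∈ 𝒵 := fun 𝒵 Z => by simp [pull]
  have card_pull : ∀ 𝒵 : Finset (Finset α), (∀ Z ∈ 𝒵, Z ⊆ S) → #(pull 𝒵) = #𝒵 := by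
    intro 𝒵 h𝒵
    refine card_bij (fun Z _ => Z.map ι) (fun Z hZ => (mem_pull _ _).1 hZ)
      (fun Z _ W _ h => map_injective _ h) fun Z hZ => ?_
    obtain ⟨W, rfl⟩ := hι Z (h𝒵 Z hZ)
    exact ⟨W, (mem_pull _ _).2 hZ, rfl⟩
  have := cross_bound_zmod (M := #S) hba hab (𝒳 := pull 𝒳) (𝒴 := pull 𝒴)
    (fun X hX => by simpa using (h𝒳 _ ((mem_pull _ _).1 hX)).2)
    (fun Y hY => by simpa using (h𝒴 _ ((mem_pull _ _).1 hY)).2)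
    (fun X hX Y hY hc => (mem_pull _ _).2 <|
      hsub _ ((mem_pull _ _).1 hX) _ (map_subset_map.2 hY) (by simpa using hc))
    (fun X hX Y hY hd => hcross _ ((mem_pull _ _).1 hX) _ ((mem_pull _ _).1 hY)
      ((disjoint_map _).2 hd))
  rwa [card_pull 𝒳 fun X hX => (h𝒳 X hX).1, card_pull 𝒴 fun Y hY => (h𝒴 Y hY).1] at this

/-- The pair `(A, x)` encodes the vector with `+1` on `A` and `-1` at `x`. -/
def IsPMPairFamily (n k : ℕ) (F : Finset (Finset ℕ × ℕ)) : Prop :=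
  ∀ p ∈ F, p.1 ⊆ range n ∧ #p.1 = k ∧ p.2 < n ∧ p.2 ∉ p.1

/-- No two pairs encode vectors with scalar product `-2`. -/
def ConflictFree (F : Finset (Finset ℕ × ℕ)) : Prop :=
  ∀ p ∈ F, ∀ q ∈ F, p.2 ∈ q.1 → q.2 ∈ p.1 → ¬ Disjoint p.1 q.1

/-- Exchange the coordinates `i` and `j`. -/
def swapPair (i j : ℕ) (p : Finset ℕ × ℕ) : Finset ℕ × ℕ :=
  (p.1.map (Equiv.swap i j).toEmbedding, Equiv.swap i j p.2)

/-- The `i`-th coordinate is smaller than the `j`-th one. -/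
def CoordLT (i j : ℕ) (p : Finset ℕ × ℕ) : Prop := (j ∈ p.1 ∧ i ∉ p.1) ∨ i = p.2

/-- Closure under moving larger coordinates to the left. -/
def IsShifted (n : ℕ) (F : Finset (Finset ℕ × ℕ)) : Prop :=
  ∀ p ∈ F, ∀ i j, i < j → j < n → CoordLT i j p → swapPair i j p ∈ F

lemma mem_swapPair_fst {i j z : ℕ} {p : Finset ℕ × ℕ} :
    z ∈ (swapPair i j p).1 ↔ Equiv.swap i j z ∈ p.1 := by
  simp [swapPair, mem_map_equiv]

lemma swapPair_swapPair (i j : ℕ) (p : Finset ℕ × ℕ) : swapPair i j (swapPair i j p) = p := by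
  ext z
  · simp [mem_swapPair_fst]
  · simp [swapPair]

lemma swapPair_injective (i j : ℕ) : Function.Injective (swapPair i j) :=
  Function.LeftInverse.injective (swapPair_swapPair i j)

lemma swapPair_conflict {i j : ℕ} {p q : Finset ℕ × ℕ} (h1 : p.2 ∈ q.1) (h2 : q.2 ∈ p.1)
    (h3 : Disjoint p.1 q.1) :
    (swapPair i j p).2 ∈ (swapPair i j q).1 ∧ (swapPair i j q).2 ∈ (swapPair i j p).1 ∧
      Disjoint (swapPair i j p).1 (swapPair i j q).1 := by
  refine ⟨?_, ?_, (disjoint_map _).2 h3⟩ <;> rw [mem_swapPair_fst] <;> simpa [swapPair]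

lemma conflict_of_swapPair_conflict {i j : ℕ} (hij : i ≠ j) {p q : Finset ℕ × ℕ}
    (hx : p.2 ∉ p.1) (hp : CoordLT i j p) (hq : ¬ CoordLT i j q)
    (h1 : (swapPair i j p).2 ∈ q.1) (h2 : q.2 ∈ (swapPair i j p).1)
    (h3 : Disjoint (swapPair i j p).1 q.1) :
    p.2 ∈ q.1 ∧ q.2 ∈ p.1 ∧ Disjoint p.1 q.1 := by
  obtain ⟨U, x⟩ := p
  obtain ⟨W, y⟩ := q
  simp only [CoordLT, not_or, not_and, not_not] at *
  rw [mem_swapPair_fst] at h2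
  simp only [swapPair] at h1 h2
  have h3' : ∀ z, Equiv.swap i j z ∈ U → z ∉ W := fun z hz =>
    disjoint_left.1 h3 (mem_swapPair_fst.2 hz)
  obtain ⟨hq1, hq2⟩ := hq
  have hi : Equiv.swap i j i = j := Equiv.swap_apply_left i j
  have hj : Equiv.swap i j j = i := Equiv.swap_apply_right i j
  have ho : ∀ z, z ≠ i → z ≠ j → Equiv.swap i j z = z := fun z => Equiv.swap_apply_of_ne_of_ne
  refine ⟨?_, ?_, disjoint_left.2 fun z hz hzW => ?_⟩
  · by_cases x = i <;> by_cases x = j <;> grind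
  · by_cases y = i <;> by_cases y = j <;> grind
  · by_cases z = i <;> by_cases z = j <;> grind

lemma IsPMPairFamily.swapPair_mem {n k i j : ℕ} {F : Finset (Finset ℕ × ℕ)}
    (hF : IsPMPairFamily n k F) (hi : i < n) (hj : j < n) {p : Finset ℕ × ℕ} (hp : p ∈ F) :
    (swapPair i j p).1 ⊆ range n ∧ #(swapPair i j p).1 = k ∧ (swapPair i j p).2 < n ∧
      (swapPair i j p).2 ∉ (swapPair i j p).1 := by
  obtain ⟨h1, h2, h3, h4⟩ := hF p hp
  have hlt : ∀ z, z < n → Equiv.swap i j z < n := fun z hz => by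
    rw [Equiv.swap_apply_def]; split_ifs <;> assumption
  refine ⟨fun z hz => ?_, by simpa [swapPair] using h2, hlt _ h3, ?_⟩
  · have := hlt _ (mem_range.1 (h1 (mem_swapPair_fst.1 hz)))
    simpa using this
  · rw [mem_swapPair_fst]
    simpa [swapPair] using h4

/-- The potential which shifting increases. -/
def shiftWeight (p : Finset ℕ × ℕ) : ℤ := p.2 - ∑ t ∈ p.1, (t : ℤ)

lemma shiftWeight_lt_swapPair {i j : ℕ} (hij : i < j) {p : Finset ℕ × ℕ} (hx : p.2 ∉ p.1)
    (hp : CoordLT i j p) : shiftWeight p < shiftWeight (swapPair i j p) := by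
  have hσ : ∀ t : ℕ, ((Equiv.swap i j t : ℕ) : ℤ)
      = t + ((if i = t then ((j : ℤ) - i) else 0) - if j = t then ((j : ℤ) - i) else 0) := by
    intro t
    rw [Equiv.swap_apply_def]
    split_ifs <;> omega
  simp only [shiftWeight, swapPair, sum_map, Equiv.coe_toEmbedding]
  simp_rw [hσ]
  rw [sum_add_distrib, sum_sub_distrib, sum_ite_eq, sum_ite_eq]
  unfold CoordLT at hp
  split_ifs <;> first | omega | grind

lemma exists_isShifted {n k : ℕ} {F : Finset (Finset ℕ × ℕ)} (hF : IsPMPairFamily n k F)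
    (hcf : ConflictFree F) :
    ∃ G, IsPMPairFamily n k G ∧ ConflictFree G ∧ #G = #F ∧ IsShifted n G := by
  classical
  let T : Finset (Finset (Finset ℕ × ℕ)) :=
    ((range n).powerset ×ˢ range n).powerset.filter
      fun G => IsPMPairFamily n k G ∧ ConflictFree G ∧ #G = #F
  have hT : ∀ G, G ∈ T ↔ IsPMPairFamily n k G ∧ ConflictFree G ∧ #G = #F := by
    intro G
    simp only [T, mem_filter, mem_powerset, and_iff_right_iff_imp]
    rintro ⟨h, -⟩ p hp
    simp [(h p hp).1, (h p hp).2.2.1]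
  obtain ⟨G, hGT, hmax⟩ := exists_max_image T (fun G => ∑ p ∈ G, shiftWeight p)
    ⟨F, (hT F).2 ⟨hF, hcf, rfl⟩⟩
  obtain ⟨hG, hGcf, hGcard⟩ := (hT G).1 hGT
  refine ⟨G, hG, hGcf, hGcard, ?_⟩
  intro p₀ hp₀ i j hij hj hlt
  by_contra hnot
  let s : Finset ℕ × ℕ → Finset ℕ × ℕ :=
    fun p => if CoordLT i j p ∧ swapPair i j p ∉ G then swapPair i j p else p
  have hs1 : ∀ p, CoordLT i j p → swapPair i j p ∉ G → s p = swapPair i j p :=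
    fun p h h' => if_pos ⟨h, h'⟩
  have hs2 : ∀ p, ¬ (CoordLT i j p ∧ swapPair i j p ∉ G) → s p = p := fun p h => if_neg h
  have hinj : Set.InjOn s G := by
    intro p hp q hq h
    by_cases h1 : CoordLT i j p ∧ swapPair i j p ∉ G <;>
      by_cases h2 : CoordLT i j q ∧ swapPair i j q ∉ G
    · rw [hs1 p h1.1 h1.2, hs1 q h2.1 h2.2] at h
      exact swapPair_injective i j h
    · rw [hs1 p h1.1 h1.2, hs2 q h2] at h
      exact absurd (h ▸ hq) h1.2
    · rw [hs2 p h1, hs1 q h2.1 h2.2] at h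
      exact absurd (h ▸ hp) h2.2
    · rwa [hs2 p h1, hs2 q h2] at h
  have hmixed : ∀ p ∈ G, ∀ q ∈ G, CoordLT i j p → swapPair i j p ∉ G →
      ¬ (CoordLT i j q ∧ swapPair i j q ∉ G) →
      (swapPair i j p).2 ∈ q.1 → q.2 ∈ (swapPair i j p).1 →
      ¬ Disjoint (swapPair i j p).1 q.1 := by
    intro p hp q hq h1 h1' h2 ha hb hd
    by_cases hq' : CoordLT i j q
    · have hqG : swapPair i j q ∈ G := by
        by_contra h; exact h2 ⟨hq', h⟩
      obtain ⟨ha', hb', hd'⟩ := swapPair_conflict (i := i) (j := j) ha hb hd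
      rw [swapPair_swapPair] at ha' hb' hd'
      exact hGcf _ hp _ hqG ha' hb' hd'
    · obtain ⟨ha', hb', hd'⟩ :=
        conflict_of_swapPair_conflict hij.ne (hG p hp).2.2.2 h1 hq' ha hb hd
      exact hGcf _ hp _ hq ha' hb' hd'
  have hmem : G.image s ∈ T := by
    refine (hT _).2 ⟨?_, ?_, (card_image_of_injOn hinj).trans hGcard⟩
    · intro p' hp'
      obtain ⟨p, hp, rfl⟩ := mem_image.1 hp'
      by_cases h1 : CoordLT i j p ∧ swapPair i j p ∉ G
      · rw [hs1 p h1.1 h1.2]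
        exact hG.swapPair_mem (hij.trans hj) hj hp
      · rw [hs2 p h1]
        exact hG p hp
    · intro p' hp' q' hq' ha hb hd
      obtain ⟨p, hp, rfl⟩ := mem_image.1 hp'
      obtain ⟨q, hq, rfl⟩ := mem_image.1 hq'
      by_cases h1 : CoordLT i j p ∧ swapPair i j p ∉ G <;>
        by_cases h2 : CoordLT i j q ∧ swapPair i j q ∉ G
      · rw [hs1 p h1.1 h1.2, hs1 q h2.1 h2.2] at ha hb hd
        obtain ⟨ha', hb', hd'⟩ := swapPair_conflict (i := i) (j := j) ha hb hd
        simp only [swapPair_swapPair] at ha' hb' hd'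
        exact hGcf _ hp _ hq ha' hb' hd'
      · rw [hs1 p h1.1 h1.2, hs2 q h2] at ha hb hd
        exact hmixed p hp q hq h1.1 h1.2 h2 ha hb hd
      · rw [hs2 p h1, hs1 q h2.1 h2.2] at ha hb hd
        exact hmixed q hq p hp h2.1 h2.2 h1 hb ha hd.symm
      · rw [hs2 p h1, hs2 q h2] at ha hb hd
        exact hGcf _ hp _ hq ha hb hd
  have := hmax _ hmem
  rw [sum_image hinj] at this
  refine absurd this (not_le.2 (sum_lt_sum (fun p hp => ?_) ⟨p₀, hp₀, ?_⟩))
  · by_cases h1 : CoordLT i j p ∧ swapPair i j p ∉ G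
    · rw [hs1 p h1.1 h1.2]
      exact (shiftWeight_lt_swapPair hij (hG p hp).2.2.2 h1.1).le
    · rw [hs2 p h1]
  · rw [hs1 p₀ hlt hnot]
    exact shiftWeight_lt_swapPair hij (hG p₀ hp₀).2.2.2 hlt

lemma IsShifted.insert_erase_mem {n i j x : ℕ} {A : Finset ℕ} {F : Finset (Finset ℕ × ℕ)}
    (hF : IsShifted n F) (h : (A, x) ∈ F) (hij : i < j) (hj : j < n) (hjA : j ∈ A) (hiA : i ∉ A)
    (hix : i ≠ x) (hjx : j ≠ x) : (insert i (A.erase j), x) ∈ F := by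
  convert hF _ h i j hij hj (Or.inl ⟨hjA, hiA⟩) using 1
  ext z
  · simp only [mem_swapPair_fst, mem_insert, mem_erase, Equiv.swap_apply_def]
    grind
  · simp [swapPair, Equiv.swap_apply_of_ne_of_ne hix.symm hjx.symm]

lemma IsShifted.mem_of_lt {n i j : ℕ} {A : Finset ℕ} {F : Finset (Finset ℕ × ℕ)}
    (hF : IsShifted n F) (h : (A, i) ∈ F) (hij : i < j) (hj : j < n) (hjA : j ∉ A) (hiA : i ∉ A) :
    (A, j) ∈ F := by
  convert hF _ h i j hij hj (Or.inr rfl) using 1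
  ext z
  · simp only [mem_swapPair_fst, Equiv.swap_apply_def]
    grind
  · simp [swapPair]

lemma IsShifted.exchange_mem {n i j : ℕ} {A : Finset ℕ} {F : Finset (Finset ℕ × ℕ)}
    (hF : IsShifted n F) (h : (A, i) ∈ F) (hij : i < j) (hj : j < n) (hjA : j ∈ A) (hiA : i ∉ A) :
    (insert i (A.erase j), j) ∈ F := by
  convert hF _ h i j hij hj (Or.inr rfl) using 1
  ext z
  · simp only [mem_swapPair_fst, mem_insert, mem_erase, Equiv.swap_apply_def]
    grind
  · simp [swapPair]

/-- The sets `A` with `(A, x) ∈ F`. -/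
def minusSlice (F : Finset (Finset ℕ × ℕ)) (x : ℕ) : Finset (Finset ℕ) :=
  (F.filter fun p => p.2 = x).image Prod.fst

lemma mem_minusSlice {F : Finset (Finset ℕ × ℕ)} {x : ℕ} {A : Finset ℕ} :
    A ∈ minusSlice F x ↔ (A, x) ∈ F := by
  simp [minusSlice]

lemma card_minusSlice (F : Finset (Finset ℕ × ℕ)) (x : ℕ) :
    #(minusSlice F x) = #(F.filter fun p => p.2 = x) := by
  refine card_image_of_injOn ?_
  rintro ⟨A, y⟩ h ⟨B, z⟩ h' rfl
  simp_all

lemma IsPMPairFamily.sum_card_minusSlice {n k : ℕ} {F : Finset (Finset ℕ × ℕ)}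
    (hF : IsPMPairFamily n k F) : ∑ x ∈ range n, #(minusSlice F x) = #F := by
  simp_rw [card_minusSlice]
  exact (card_eq_sum_card_fiberwise fun p hp => by simpa using (hF p hp).2.2.1).symm

lemma sum_card_memberSubfamily {n k : ℕ} {𝓑 : Finset (Finset ℕ)}
    (h𝓑 : ∀ B ∈ 𝓑, B ⊆ range n ∧ #B = k) :
    ∑ x ∈ range n, #(𝓑.memberSubfamily x) = k * #𝓑 := by
  have h1 : ∀ x, #(𝓑.memberSubfamily x) = #(𝓑.filter fun B => x ∈ B) := fun x =>
    card_image_of_injOn ((erase_injOn' x).mono fun B hB => by simpa using (mem_filter.1 hB).2)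
  simp_rw [h1]
  refine (sum_card_bipartiteAbove_eq_sum_card_bipartiteBelow
    (r := fun (x : ℕ) (B : Finset ℕ) => x ∈ B)).trans ?_
  rw [sum_const_nat (m := k), mul_comm]
  intro B hB
  rw [← (h𝓑 B hB).2]
  congr 1
  ext x
  simp only [bipartiteBelow, mem_filter, mem_range, and_iff_right_iff_imp]
  exact fun hx => mem_range.1 ((h𝓑 B hB).1 hx)

section TopCoordinate

variable {M r : ℕ} {𝓑 : Finset (Finset ℕ)} {W : Finset (Finset ℕ × ℕ)}

lemma minusSlice_bound (hM : 2 * r + 1 ≤ M) (h𝓑 : ∀ B ∈ 𝓑, B ⊆ range (M + 1) ∧ #B = r + 1)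
    (hW : IsPMPairFamily (M + 1) r W) (hsupp : ∀ A x, (A, x) ∈ W → insert x A ∈ 𝓑)
    (hcross : ∀ A x, (A, x) ∈ W → ∀ B ∈ 𝓑, x ∈ B → ¬ Disjoint A B) {x : ℕ}
    (hx : x ∈ range (M + 1)) :
    r * #(𝓑.memberSubfamily x) + (M - r) * #(minusSlice W x) ≤ r * M.choose r := by
  have hS : #((range (M + 1)).erase x) = M := by simp [card_erase_of_mem hx]
  have := cross_bound (S := (range (M + 1)).erase x) (a := r) (b := r)
    (𝒳 := minusSlice W x) (𝒴 := 𝓑.memberSubfamily x) (card_pos.1 (by omega)) le_rfl (by omega)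
    (fun A hA => by
      obtain ⟨h1, h2, -, h4⟩ := hW _ (mem_minusSlice.1 hA)
      exact ⟨subset_erase.2 ⟨h1, h4⟩, h2⟩)
    (fun B hB => by
      obtain ⟨h1, h2⟩ := mem_memberSubfamily.1 hB
      obtain ⟨h3, h4⟩ := h𝓑 _ h1
      rw [card_insert_of_notMem h2] at h4
      exact ⟨subset_erase.2 ⟨(subset_insert _ _).trans h3, h2⟩, by omega⟩)
    (fun A hA Y hY hc => by
      obtain ⟨h1, h2, -, h4⟩ := hW _ (mem_minusSlice.1 hA)
      obtain rfl := eq_of_subset_of_card_le hY (h2.trans hc.symm).le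
      exact mem_memberSubfamily.2 ⟨hsupp _ _ (mem_minusSlice.1 hA), h4⟩)
    (fun A hA B hB hd => by
      obtain ⟨h1, h2⟩ := mem_memberSubfamily.1 hB
      refine hcross _ _ (mem_minusSlice.1 hA) _ h1 (mem_insert_self _ _) ?_
      exact disjoint_insert_right.2 ⟨(hW _ (mem_minusSlice.1 hA)).2.2.2, hd⟩)
  rw [hS] at this
  refine Nat.le_of_mul_le_mul_right ?_ (Nat.choose_pos (show r ≤ M by omega))
  rwa [add_mul]

lemma card_add_card_le_of_le (hM : 2 * r + 1 ≤ M) (hM' : M + 1 ≤ (r + 1) ^ 2)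
    (h𝓑 : ∀ B ∈ 𝓑, B ⊆ range (M + 1) ∧ #B = r + 1)
    (hW : IsPMPairFamily (M + 1) r W) (hsupp : ∀ A x, (A, x) ∈ W → insert x A ∈ 𝓑)
    (hcross : ∀ A x, (A, x) ∈ W → ∀ B ∈ 𝓑, x ∈ B → ¬ Disjoint A B)
    (hcase : M + 1 = (r + 1) ^ 2 ∨ M.choose r ≤ #𝓑) :
    #𝓑 + #W ≤ (r + 1) * M.choose r := by
  have hsum := sum_le_sum fun x hx => minusSlice_bound hM h𝓑 hW hsupp hcross (x := x) hx
  rw [sum_add_distrib, ← mul_sum, ← mul_sum, sum_card_memberSubfamily h𝓑, hW.sum_card_minusSlice,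
    sum_const, card_range, smul_eq_mul] at hsum
  obtain ⟨e, rfl⟩ := Nat.exists_eq_add_of_le (show r ≤ M by omega)
  rw [Nat.add_sub_cancel_left] at hsum
  set N := (r + e).choose r
  have he : e ≤ r * (r + 1) := by nlinarith
  have hprod : e * #𝓑 + r * (r + 1) * N ≤ e * N + r * (r + 1) * #𝓑 := by
    rcases hcase with h | h
    · have : e = r * (r + 1) := by nlinarith
      rw [← this]
      exact (add_comm _ _).le
    · obtain ⟨f, hf⟩ := Nat.exists_eq_add_of_le h
      obtain ⟨g, hg⟩ := Nat.exists_eq_add_of_le he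
      rw [hf, hg]
      nlinarith [Nat.zero_le (f * g)]
  refine Nat.le_of_mul_le_mul_left (c := e) ?_ (by omega)
  nlinarith

lemma minusSlice_bound_of_shifted {q f : ℕ} (hf : q + 2 ≤ f)
    (hW : IsPMPairFamily (q + f + 2) (q + 1) W) (hsupp : ∀ A x, (A, x) ∈ W → insert x A ∈ 𝓑)
    (hcross : ∀ A x, (A, x) ∈ W → ∀ B ∈ 𝓑, x ∈ B → ¬ Disjoint A B)
    (hshift : ∀ A x, (A, x) ∈ W → 0 ∉ A → x ≠ 0 → ∀ a ∈ A, (insert 0 (A.erase a), x) ∈ W)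
    {x : ℕ} (hx : x < q + f + 2) (hx0 : x ≠ 0) :
    q * f * #(minusSlice W x) + (f - 1 - q) * #((minusSlice W x).nonMemberSubfamily 0)
      ≤ q * f * (q + f).choose q := by
  have hS : #(((range (q + f + 2)).erase x).erase 0) = q + f := by
    rw [card_erase_of_mem (by simp [hx0.symm]), card_erase_of_mem (by simpa using hx), card_range]
    omega
  have := cross_bound (S := ((range (q + f + 2)).erase x).erase 0) (a := q + 1) (b := q)
    (𝒳 := (minusSlice W x).nonMemberSubfamily 0) (𝒴 := (minusSlice W x).memberSubfamily 0)
    (card_pos.1 (by omega)) (by omega) (by omega)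
    (fun A hA => by
      obtain ⟨hA, h0⟩ := mem_nonMemberSubfamily.1 hA
      obtain ⟨h1, h2, -, h4⟩ := hW _ (mem_minusSlice.1 hA)
      exact ⟨subset_erase.2 ⟨subset_erase.2 ⟨h1, h4⟩, h0⟩, h2⟩)
    (fun Y hY => by
      obtain ⟨hA, h0⟩ := mem_memberSubfamily.1 hY
      obtain ⟨h1, h2, -, h4⟩ := hW _ (mem_minusSlice.1 hA)
      simp only [card_insert_of_notMem h0] at h2
      exact ⟨subset_erase.2 ⟨subset_erase.2 ⟨(subset_insert _ _).trans h1,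
        fun h => h4 (mem_insert_of_mem h)⟩, h0⟩, by omega⟩)
    (fun A hA Y hY hc => by
      obtain ⟨hA, h0⟩ := mem_nonMemberSubfamily.1 hA
      obtain ⟨h1, h2, -, h4⟩ := hW _ (mem_minusSlice.1 hA)
      obtain ⟨a, ha, haY⟩ := exists_of_ssubset
        (Finset.ssubset_iff_subset_ne.2 ⟨hY, fun h => by rw [h] at hc; simp only at h2; omega⟩)
      obtain rfl : Y = A.erase a := eq_of_subset_of_card_le (subset_erase.2 ⟨hY, haY⟩)
        (by rw [card_erase_of_mem ha]; simp only at h2; omega)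
      exact mem_memberSubfamily.2 ⟨mem_minusSlice.2 (hshift _ _ (mem_minusSlice.1 hA) h0 hx0 a ha),
        fun h => h0 (mem_of_mem_erase h)⟩)
    (fun A hA Y hY hd => by
      obtain ⟨hA, h0⟩ := mem_nonMemberSubfamily.1 hA
      obtain ⟨hY, -⟩ := mem_memberSubfamily.1 hY
      refine hcross _ _ (mem_minusSlice.1 hA) _ (hsupp _ _ (mem_minusSlice.1 hY)) (mem_insert_self _ _) ?_
      exact disjoint_insert_right.2 ⟨(hW _ (mem_minusSlice.1 hA)).2.2.2,
        disjoint_insert_right.2 ⟨h0, hd⟩⟩)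
  rw [hS] at this
  have hcard := card_memberSubfamily_add_card_nonMemberSubfamily 0 (minusSlice W x)
  have hch := Nat.choose_succ_right_eq (q + f) q
  rw [Nat.add_sub_cancel_left] at hch
  rw [← hcard]
  set P := (q + f).choose q
  have hP : 0 < P := Nat.choose_pos (by omega)
  have h' := Nat.mul_le_mul_right (q + 1) this
  obtain ⟨g, rfl⟩ := Nat.exists_eq_add_of_le (show q + 1 ≤ f by omega)
  rw [show q + (q + 1 + g) - (q + 1) = q + g by omega] at h'
  rw [show q + 1 + g - 1 - q = g by omega]
  set X := #((minusSlice W x).nonMemberSubfamily 0)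
  set Y := #((minusSlice W x).memberSubfamily 0)
  set c := (q + (q + 1 + g)).choose (q + 1)
  refine Nat.le_of_mul_le_mul_right ?_ hP
  calc (q * (q + 1 + g) * (Y + X) + g * X) * P
      = q * Y * (P * (q + 1 + g)) + (q + g) * X * P * (q + 1) := by ring
    _ = (q * Y * c + (q + g) * X * P) * (q + 1) := by rw [← hch]; ring
    _ ≤ q * c * P * (q + 1) := h'
    _ = q * (c * (q + 1)) * P := by ring
    _ = _ := by rw [hch]; ring

lemma card_le_of_shifted {q f : ℕ} (hq : 0 < q) (hf : 2 * q + 1 ≤ f)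
    (hW : IsPMPairFamily (q + f + 2) (q + 1) W) (hsupp : ∀ A x, (A, x) ∈ W → insert x A ∈ 𝓑)
    (hcross : ∀ A x, (A, x) ∈ W → ∀ B ∈ 𝓑, x ∈ B → ¬ Disjoint A B)
    (hshift : ∀ A x, (A, x) ∈ W → 0 ∉ A → x ≠ 0 → ∀ a ∈ A, (insert 0 (A.erase a), x) ∈ W)
    (hzero : ∀ A, (A, 0) ∈ W → ∀ y < q + f + 2, y ∉ A → (A, y) ∈ W) :
    #W ≤ (q + f + 1) * (q + f).choose q := by
  have hsum := sum_le_sum fun x (hx : x ∈ (range (q + f + 2)).erase 0) =>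
    minusSlice_bound_of_shifted (by omega) hW hsupp hcross hshift (mem_range.1 (mem_of_mem_erase hx))
      (ne_of_mem_erase hx)
  have h0mem : 0 ∈ range (q + f + 2) := by simp
  rw [sum_add_distrib, ← mul_sum, ← mul_sum, sum_const, card_erase_of_mem h0mem, card_range,
    smul_eq_mul] at hsum
  have hlow : f * #(minusSlice W 0)
      ≤ ∑ x ∈ (range (q + f + 2)).erase 0, #((minusSlice W x).nonMemberSubfamily 0) := by
    have h1 : ∀ A ∈ minusSlice W 0, #(((range (q + f + 2)).erase 0).filter fun x => x ∉ A) = f := by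
      intro A hA
      obtain ⟨h1, h2, -, h4⟩ : A ⊆ _ ∧ #A = _ ∧ 0 < _ ∧ 0 ∉ A := hW _ (mem_minusSlice.1 hA)
      have : ((range (q + f + 2)).erase 0).filter (fun x => x ∉ A)
          = ((range (q + f + 2)).erase 0) \ A := by ext; simp
      rw [this, card_sdiff_of_subset (subset_erase.2 ⟨h1, h4⟩), card_erase_of_mem h0mem,
        card_range]
      omega
    calc f * #(minusSlice W 0)
        = ∑ A ∈ minusSlice W 0, #(((range (q + f + 2)).erase 0).filter fun x => x ∉ A) := by
          rw [sum_const_nat h1, mul_comm]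
      _ = ∑ x ∈ (range (q + f + 2)).erase 0, #((minusSlice W 0).filter fun A => x ∉ A) :=
          (sum_card_bipartiteAbove_eq_sum_card_bipartiteBelow
            (r := fun (A : Finset ℕ) (x : ℕ) => x ∉ A))
      _ ≤ _ := sum_le_sum fun x hx => card_le_card fun A hA => by
          obtain ⟨hA, hxA⟩ := mem_filter.1 hA
          exact mem_nonMemberSubfamily.2 ⟨mem_minusSlice.2 (hzero A (mem_minusSlice.1 hA) x
            (mem_range.1 (mem_of_mem_erase hx)) hxA), (hW _ (mem_minusSlice.1 hA)).2.2.2⟩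
  have hcard := hW.sum_card_minusSlice
  rw [← add_sum_erase _ _ h0mem] at hcard
  rw [show q + f + 2 - 1 = q + f + 1 by omega] at hsum
  rw [← hcard]
  refine Nat.le_of_mul_le_mul_left (c := q * f) ?_ (Nat.mul_pos hq (by omega))
  have h2 : q * (f * #(minusSlice W 0)) ≤ (f - 1 - q) *
      ∑ x ∈ (range (q + f + 2)).erase 0, #((minusSlice W x).nonMemberSubfamily 0) :=
    Nat.mul_le_mul (by omega) hlow
  nlinarith

lemma card_add_card_le (hr : 0 < r) (hM : 2 * r + 1 ≤ M) (hM' : M + 1 ≤ (r + 1) ^ 2)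
    (h𝓑 : ∀ B ∈ 𝓑, B ⊆ range (M + 1) ∧ #B = r + 1)
    (hW : IsPMPairFamily (M + 1) r W) (hsupp : ∀ A x, (A, x) ∈ W → insert x A ∈ 𝓑)
    (hcross : ∀ A x, (A, x) ∈ W → ∀ B ∈ 𝓑, x ∈ B → ¬ Disjoint A B)
    (hshift : ∀ A x, (A, x) ∈ W → 0 ∉ A → x ≠ 0 → ∀ a ∈ A, (insert 0 (A.erase a), x) ∈ W)
    (hzero : ∀ A, (A, 0) ∈ W → ∀ y < M + 1, y ∉ A → (A, y) ∈ W)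
    (hsmall : M + 1 ≤ r ^ 2 + 1 → #W ≤ r * M.choose r) :
    #𝓑 + #W ≤ (r + 1) * M.choose r := by
  by_cases hcase : M + 1 = (r + 1) ^ 2 ∨ M.choose r ≤ #𝓑
  · exact card_add_card_le_of_le hM hM' h𝓑 hW hsupp hcross hcase
  rw [not_or, not_le] at hcase
  suffices #W ≤ r * M.choose r by nlinarith
  by_cases hs : M + 1 ≤ r ^ 2 + 1
  · exact hsmall hs
  obtain ⟨q, rfl⟩ : ∃ q, r = q + 1 := ⟨r - 1, by omega⟩
  obtain ⟨f, rfl⟩ : ∃ f, M = q + f + 1 := ⟨M - q - 1, by omega⟩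
  have hq : 0 < q := by
    rcases Nat.eq_zero_or_pos q with rfl | h
    · norm_num at *; omega
    · exact h
  have := card_le_of_shifted hq (by nlinarith) hW hsupp hcross hshift hzero
  rw [Nat.add_one_mul_choose_eq] at this
  rwa [mul_comm (q + 1)]

end TopCoordinate

lemma card_le_of_eq_two_mul {k : ℕ} (hk : 1 ≤ k) {F : Finset (Finset ℕ × ℕ)}
    (hF : IsPMPairFamily (2 * k) k F) (hcf : ConflictFree F) :
    #F ≤ k * (2 * k - 1).choose k := by
  set 𝒜 := F.image Prod.fst with h𝒜
  have hA : ∀ A ∈ 𝒜, A ⊆ range (2 * k) ∧ #A = k := by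
    intro A hA
    obtain ⟨p, hp, rfl⟩ := mem_image.1 hA
    exact ⟨(hF p hp).1, (hF p hp).2.1⟩
  have hcompl : ∀ A ⊆ range (2 * k), #A = k → #(range (2 * k) \ A) = k := by
    intro A hA hc
    rw [card_sdiff_of_subset hA, card_range, hc]
    omega
  have h1 : #F ≤ k * #𝒜 := by
    refine card_le_mul_card_image F k fun A hA' => ?_
    obtain ⟨hs, hc⟩ := hA A hA'
    rw [← hcompl A hs hc]
    refine card_le_card_of_injOn Prod.snd (fun p hp => ?_) fun p hp q hq h => ?_
    · obtain ⟨hpF, rfl⟩ := mem_filter.1 hp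
      simpa using (hF p hpF).2.2
    · exact Prod.ext ((mem_filter.1 hp).2.trans (mem_filter.1 hq).2.symm) h
  have hdisj : Disjoint 𝒜 (𝒜.image fun A => range (2 * k) \ A) := by
    refine disjoint_left.2 fun A hA1 hA2 => ?_
    obtain ⟨B, hB, rfl⟩ := mem_image.1 hA2
    obtain ⟨p, hp, hpA⟩ := mem_image.1 hA1
    obtain ⟨q, hq, rfl⟩ := mem_image.1 hB
    obtain ⟨-, -, hp3, hp4⟩ := hF p hp
    obtain ⟨-, -, hq3, hq4⟩ := hF q hq
    refine hcf p hp q hq ?_ ?_ ?_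
    · rw [hpA] at hp4
      simpa [hp3] using hp4
    · simp [hpA, hq3, hq4]
    · rw [hpA]
      exact sdiff_disjoint
  have h2 : #𝒜 + #𝒜 ≤ (2 * k).choose k := by
    have hinj : Set.InjOn (fun A => range (2 * k) \ A) 𝒜 := by
      intro A hA' B hB' h
      rw [← inter_eq_right.2 (hA A hA').1, ← inter_eq_right.2 (hA B hB').1,
        ← sdiff_sdiff_self_left, ← sdiff_sdiff_self_left]
      exact congrArg (range (2 * k) \ ·) h
    have := card_union_of_disjoint hdisj
    rw [card_image_of_injOn hinj] at this
    rw [← this, ← card_range (2 * k), ← card_powersetCard, card_range]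
    refine card_le_card fun A hA' => mem_powersetCard.2 ?_
    rcases mem_union.1 hA' with h | h
    · exact hA A h
    · obtain ⟨B, hB, rfl⟩ := mem_image.1 h
      exact ⟨sdiff_subset, hcompl B (hA B hB).1 (hA B hB).2⟩
  have h3 : (2 * k).choose k = 2 * (2 * k - 1).choose k := by
    obtain ⟨j, rfl⟩ := Nat.exists_eq_add_of_le' hk
    rw [show 2 * (j + 1) - 1 = 2 * j + 1 by omega, show 2 * (j + 1) = 2 * j + 1 + 1 by ring,
      Nat.choose_succ_succ, Nat.choose_symm_half]
    ring
  exact h1.trans (Nat.mul_le_mul_left k (by omega))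

/-- The members of `F` containing `m`, with `m` removed. -/
def linkAt (F : Finset (Finset ℕ × ℕ)) (m : ℕ) : Finset (Finset ℕ × ℕ) :=
  (F.filter fun p => m ∈ p.1).image fun p => (p.1.erase m, p.2)

lemma mem_linkAt {F : Finset (Finset ℕ × ℕ)} {m x : ℕ} {A : Finset ℕ} :
    (A, x) ∈ linkAt F m ↔ (insert m A, x) ∈ F ∧ m ∉ A := by
  simp only [linkAt, mem_image, mem_filter, Prod.exists, Prod.mk.injEq]
  constructor
  · rintro ⟨B, y, ⟨hB, hm⟩, rfl, rfl⟩
    exact ⟨by rwa [insert_erase hm], notMem_erase m B⟩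
  · rintro ⟨h, hm⟩
    exact ⟨_, _, ⟨h, mem_insert_self m A⟩, erase_insert hm, rfl⟩

lemma card_linkAt (F : Finset (Finset ℕ × ℕ)) (m : ℕ) :
    #(linkAt F m) = #(F.filter fun p => m ∈ p.1) := by
  refine card_image_of_injOn ?_
  rintro ⟨A, x⟩ hA ⟨B, y⟩ hB h
  simp only [Prod.mk.injEq] at h
  obtain ⟨h, rfl⟩ := h
  have hA' : m ∈ A := (mem_filter.1 hA).2
  have hB' : m ∈ B := (mem_filter.1 hB).2
  rw [← insert_erase hA', h, insert_erase hB']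

lemma IsPMPairFamily.linkAt {m r : ℕ} {F : Finset (Finset ℕ × ℕ)}
    (hF : IsPMPairFamily (m + 1) (r + 1) F) : IsPMPairFamily m r (linkAt F m) := by
  rintro ⟨A, x⟩ h
  obtain ⟨h, hm⟩ := mem_linkAt.1 h
  obtain ⟨h1, h2, h3, h4⟩ : insert m A ⊆ range (m + 1) ∧ #(insert m A) = r + 1 ∧
    x < m + 1 ∧ x ∉ insert m A := hF _ h
  rw [card_insert_of_notMem hm] at h2
  rw [mem_insert, not_or] at h4
  refine ⟨fun z hz => ?_, by simpa using h2, by simp only; omega, h4.2⟩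
  have := mem_range.1 (h1 (mem_insert_of_mem hz))
  have hzm : z ≠ m := fun h => hm (h ▸ hz)
  exact mem_range.2 (by omega)

lemma ConflictFree.linkAt {m r : ℕ} (hm : 2 * r < m) {F : Finset (Finset ℕ × ℕ)}
    (hF : IsPMPairFamily (m + 1) (r + 1) F) (hcf : ConflictFree F) (hs : IsShifted (m + 1) F) :
    ConflictFree (linkAt F m) := by
  rintro ⟨A, x⟩ hA ⟨B, y⟩ hB hxB hyA hd
  have hA' := hF.linkAt _ hA
  have hB' := hF.linkAt _ hB
  simp only at hxB hyA hd hA' hB'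
  obtain ⟨hAF, hmA⟩ := mem_linkAt.1 hA
  obtain ⟨hBF, hmB⟩ := mem_linkAt.1 hB
  obtain ⟨z, hz, hzAB⟩ : ∃ z ∈ range m, z ∉ A ∪ B := by
    refine exists_mem_notMem_of_card_lt_card ?_
    rw [card_range]
    have := card_union_le A B
    omega
  rw [mem_union, not_or] at hzAB
  have hzm := mem_range.1 hz
  have := hs.insert_erase_mem hAF hzm (by omega) (mem_insert_self m A)
    (by simp [hzAB.1, hzm.ne]) (fun h => hzAB.2 (h ▸ hxB)) (by omega)
  rw [erase_insert hmA] at this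
  refine hcf _ this _ hBF (mem_insert_of_mem hxB) (mem_insert_of_mem hyA) ?_
  refine disjoint_insert_left.2 ⟨?_, disjoint_insert_right.2 ⟨hmA, hd⟩⟩
  simp [hzAB.2, hzm.ne]

lemma card_eq_add_card_linkAt {m k : ℕ} {F : Finset (Finset ℕ × ℕ)}
    (hF : IsPMPairFamily (m + 1) k F) :
    #F = #(F.filter fun p => m ∉ p.1 ∧ p.2 ≠ m) + #(minusSlice F m) + #(linkAt F m) := by
  rw [card_linkAt, card_minusSlice, ← card_filter_add_card_filter_not (s := F) (fun p => m ∈ p.1),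
    ← card_filter_add_card_filter_not (s := F.filter fun p => m ∉ p.1) (fun p => p.2 = m),
    filter_filter, filter_filter]
  have : F.filter (fun p => m ∉ p.1 ∧ p.2 = m) = F.filter fun p => p.2 = m := by
    refine filter_congr fun p hp => ⟨fun h => h.2, fun h => ⟨?_, h⟩⟩
    rw [← h]
    exact (hF p hp).2.2.2
  rw [this]
  ring

lemma ConflictFree.mono {F G : Finset (Finset ℕ × ℕ)} (hF : ConflictFree F) (h : G ⊆ F) :
    ConflictFree G := fun p hp q hq => hF p (h hp) q (h hq)

theorem card_le_of_conflictFree {k : ℕ} (hk : 1 ≤ k) : ∀ n, 2 * k ≤ n → n ≤ k ^ 2 + 1 →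
    ∀ F : Finset (Finset ℕ × ℕ), IsPMPairFamily n k F → ConflictFree F →
      #F ≤ k * (n - 1).choose k := by
  induction k, hk using Nat.le_induction with
  | base =>
    intro n h1 h2 F hF hcf
    obtain rfl : n = 2 := by omega
    exact card_le_of_eq_two_mul le_rfl hF hcf
  | succ r hr ihr =>
    intro n hn
    induction n, hn using Nat.le_induction with
    | base =>
      intro _ F hF hcf
      exact card_le_of_eq_two_mul (by omega) hF hcf
    | succ m hm ihm =>
      intro hle F₀ hF₀ hcf₀
      obtain ⟨F, hF, hcf, hcard, hs⟩ := exists_isShifted hF₀ hcf₀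
      rw [← hcard]
      obtain ⟨M, rfl⟩ : ∃ M, m = M + 1 := ⟨m - 1, by omega⟩
      have hrest : #(F.filter fun p => M + 1 ∉ p.1 ∧ p.2 ≠ M + 1) ≤ (r + 1) * M.choose (r + 1) := by
        refine ihm (by omega) _ (fun p hp => ?_) (hcf.mono (filter_subset _ _))
        obtain ⟨hp, h1, h2⟩ := mem_filter.1 hp
        obtain ⟨h3, h4, h5, h6⟩ := hF p hp
        refine ⟨fun z hz => ?_, h4, by omega, h6⟩
        have := mem_range.1 (h3 hz)
        have : z ≠ M + 1 := fun h => h1 (h ▸ hz)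
        exact mem_range.2 (by omega)
      have htop : #(minusSlice F (M + 1)) + #(linkAt F (M + 1)) ≤ (r + 1) * M.choose r := by
        have hW := hF.linkAt
        refine card_add_card_le hr (by omega) (by omega) ?_ hW ?_ ?_ ?_ ?_ ?_
        · intro B hB
          obtain ⟨h1, h2, -, h4⟩ : B ⊆ range (M + 1 + 1) ∧ #B = r + 1 ∧ _ ∧ M + 1 ∉ B :=
            hF _ (mem_minusSlice.1 hB)
          refine ⟨fun z hz => ?_, h2⟩
          have := mem_range.1 (h1 hz)
          have : z ≠ M + 1 := fun h => h4 (h ▸ hz)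
          exact mem_range.2 (by omega)
        · intro A x hA
          obtain ⟨-, -, hx, hxA⟩ : _ ∧ _ ∧ x < M + 1 ∧ x ∉ A := hW _ hA
          obtain ⟨hAF, hmA⟩ := mem_linkAt.1 hA
          have := hs.exchange_mem hAF hx (by omega) (mem_insert_self _ A)
            (by simp [hx.ne, hxA])
          rw [erase_insert hmA] at this
          exact mem_minusSlice.2 this
        · intro A x hA B hB hxB hd
          obtain ⟨hAF, hmA⟩ := mem_linkAt.1 hA
          have hBF := mem_minusSlice.1 hB
          exact hcf _ hAF _ hBF hxB (mem_insert_self _ A)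
            (disjoint_insert_left.2 ⟨(hF _ hBF).2.2.2, hd⟩)
        · intro A x hA h0 hx0 a ha
          obtain ⟨h1, -, hx, hxA⟩ : A ⊆ range (M + 1) ∧ _ ∧ x < M + 1 ∧ x ∉ A := hW _ hA
          obtain ⟨hAF, hmA⟩ := mem_linkAt.1 hA
          have haM := mem_range.1 (h1 ha)
          have ha0 : a ≠ 0 := fun h => h0 (h ▸ ha)
          have := hs.insert_erase_mem hAF (i := 0) (j := a) (by omega) (by omega)
            (mem_insert_of_mem ha) (by simp [h0]) hx0.symm (fun h => hxA (h ▸ ha))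
          rw [erase_insert_of_ne (by omega), insert_comm] at this
          refine mem_linkAt.2 ⟨this, ?_⟩
          simp [hmA]
        · intro A hA y hy hyA
          obtain ⟨hAF, hmA⟩ := mem_linkAt.1 hA
          rcases Nat.eq_zero_or_pos y with rfl | hy0
          · exact hA
          · refine mem_linkAt.2 ⟨hs.mem_of_lt hAF hy0 (by omega) (by simp [hyA, hy.ne]) ?_, hmA⟩
            exact (hF _ hAF).2.2.2
        · intro hsmall
          exact ihr (M + 1) (by omega) hsmall _ hW (hcf.linkAt (by omega) hF hs)
      rw [card_eq_add_card_linkAt hF, Nat.add_sub_cancel, Nat.choose_succ_succ]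
      linarith

/-- The vector of length `n` encoded by a pair. -/
def pairVec (n : ℕ) (p : Finset ℕ × ℕ) (i : Fin n) : ℤ :=
  if (i : ℕ) ∈ p.1 then 1 else if (i : ℕ) = p.2 then -1 else 0

lemma dotZ_pairVec_of_conflict {n : ℕ} {p q : Finset ℕ × ℕ} (hp : p.2 < n) (hq : q.2 < n)
    (hpp : p.2 ∉ p.1) (hqq : q.2 ∉ q.1) (h1 : p.2 ∈ q.1) (h2 : q.2 ∈ p.1)
    (h3 : Disjoint p.1 q.1) : dotZ (pairVec n p) (pairVec n q) = -2 := by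
  have : ∀ i : Fin n, pairVec n p i * pairVec n q i
      = (if (⟨p.2, hp⟩ : Fin n) = i then -1 else 0) + if (⟨q.2, hq⟩ : Fin n) = i then -1 else 0 := by
    intro i
    simp only [pairVec, Fin.ext_iff]
    have : (i : ℕ) ∈ p.1 → (i : ℕ) ∉ q.1 := fun h => disjoint_left.1 h3 h
    split_ifs <;> grind
  simp_rw [dotZ, this, sum_add_distrib, sum_ite_eq]
  simp

lemma neg_two_lt_dotZ_pairVec {n : ℕ} (hn : 0 < n) {p q : Finset ℕ × ℕ} (hp : p.2 < n)
    (hq : q.2 < n) (hpp : p.2 ∉ p.1) (hqq : q.2 ∉ q.1) (h1 : 0 ∈ p.1) (h2 : 0 ∈ q.1) :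
    -2 < dotZ (pairVec n p) (pairVec n q) := by
  have : ∀ i : Fin n, ((if (⟨0, hn⟩ : Fin n) = i then 1 else 0) +
      (if (⟨p.2, hp⟩ : Fin n) = i then -1 else 0) + if (⟨q.2, hq⟩ : Fin n) = i then -1 else 0)
      ≤ pairVec n p i * pairVec n q i := by
    intro i
    simp only [pairVec, Fin.ext_iff]
    split_ifs <;> grind
  have := sum_le_sum fun i (_ : i ∈ (univ : Finset (Fin n))) => this i
  simp_rw [sum_add_distrib, sum_ite_eq] at this
  simp only [mem_univ, if_true] at this
  rw [dotZ]
  omega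

lemma card_fin_val_mem {n : ℕ} {A : Finset ℕ} (hA : A ⊆ range n) :
    #{i : Fin n | (i : ℕ) ∈ A} = #A := by
  rw [← card_map Fin.valEmbedding]
  congr 1
  ext z
  simp only [mem_map, mem_filter, mem_univ, true_and, Fin.valEmbedding_apply]
  exact ⟨by rintro ⟨i, hi, rfl⟩; exact hi, fun hz => ⟨⟨z, mem_range.1 (hA hz)⟩, hz, rfl⟩⟩

lemma isPMVec_pairVec {n k : ℕ} {p : Finset ℕ × ℕ} (h1 : p.1 ⊆ range n) (h2 : #p.1 = k)
    (h3 : p.2 < n) (h4 : p.2 ∉ p.1) : IsPMVec n k 1 (pairVec n p) := by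
  refine ⟨fun i => ?_, ?_, ?_⟩
  · unfold pairVec; split_ifs <;> simp
  · rw [← h2, ← card_fin_val_mem h1]
    congr 1
    ext i
    simp only [mem_filter, mem_univ, true_and]
    unfold pairVec
    split_ifs <;> simp_all
  · rw [card_eq_one]
    refine ⟨⟨p.2, h3⟩, ?_⟩
    ext i
    simp only [mem_filter, mem_univ, true_and, mem_singleton, Fin.ext_iff]
    unfold pairVec
    split_ifs <;> simp_all
    grind

lemma IsPMVec.exists_pairVec {n k : ℕ} {v : Fin n → ℤ} (hv : IsPMVec n k 1 v) :
    ∃ p : Finset ℕ × ℕ, p.1 ⊆ range n ∧ #p.1 = k ∧ p.2 < n ∧ p.2 ∉ p.1 ∧ pairVec n p = v := by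
  obtain ⟨h1, h2, h3⟩ := hv
  obtain ⟨x, hx⟩ := card_eq_one.1 h3
  have hx' : ∀ i, v i = -1 ↔ i = x := fun i => by
    have := Finset.ext_iff.1 hx i
    simpa using this
  have hmem : ∀ i : Fin n, (i : ℕ) ∈ (univ.filter fun i => v i = 1).map Fin.valEmbedding ↔
      v i = 1 := fun i => by simp [← Fin.ext_iff]
  refine ⟨((univ.filter fun i => v i = 1).map Fin.valEmbedding, x), ?_, ?_, x.2, ?_, ?_⟩
  · intro z hz
    obtain ⟨i, -, rfl⟩ := mem_map.1 hz
    simp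
  · simpa using h2
  · rw [hmem, (hx' x).2 rfl]
    norm_num
  · funext i
    unfold pairVec
    simp only [hmem]
    have := h1 i
    have := hx' i
    rw [Fin.ext_iff] at this
    split_ifs <;> grind

lemma pairVec_inj {n : ℕ} {p q : Finset ℕ × ℕ} (hp1 : p.1 ⊆ range n) (hp2 : p.2 < n)
    (hp3 : p.2 ∉ p.1) (hq1 : q.1 ⊆ range n) (h : pairVec n p = pairVec n q) : p = q := by
  have hval : ∀ i, i < n → ((i ∈ p.1 ↔ i ∈ q.1) ∧ (i = p.2 → i = q.2)) := by
    intro i hi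
    have := congrFun h ⟨i, hi⟩
    simp only [pairVec] at this
    split_ifs at this <;> grind
  refine Prod.ext (Finset.ext fun z => ⟨fun hz => ?_, fun hz => ?_⟩) ((hval _ hp2).2 rfl)
  · exact (hval z (mem_range.1 (hp1 hz))).1.1 hz
  · exact (hval z (mem_range.1 (hq1 hz))).1.2 hz

lemma exists_star {n k : ℕ} (hk : 1 ≤ k) (hn : k < n) :
    ∃ F : Finset (Fin n → ℤ), (∀ v ∈ F, IsPMVec n k 1 v) ∧
      (∀ v ∈ F, ∀ w ∈ F, -2 < dotZ v w) ∧ #F = k * (n - 1).choose k := by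
  let R := (range n).erase 0
  have hR : #R = n - 1 := by
    rw [card_erase_of_mem (mem_range.2 (by omega)), card_range]
  let P : Finset (Σ _ : Finset ℕ, ℕ) := (powersetCard (k - 1) R).sigma fun A => R \ A
  let g : (Σ _ : Finset ℕ, ℕ) → Finset ℕ × ℕ := fun s => (insert 0 s.1, s.2)
  have h0R : 0 ∉ R := notMem_erase 0 _
  have hP : ∀ s ∈ P, (g s).1 ⊆ range n ∧ #(g s).1 = k ∧ (g s).2 < n ∧ (g s).2 ∉ (g s).1 ∧
      0 ∉ s.1 := by
    rintro ⟨A, x⟩ hs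
    obtain ⟨hA, hx⟩ := mem_sigma.1 hs
    obtain ⟨hAR, hAc⟩ := mem_powersetCard.1 hA
    obtain ⟨hxR, hxA⟩ := mem_sdiff.1 hx
    simp only at hAR hAc hxR hxA
    have h0A : 0 ∉ A := fun h => h0R (hAR h)
    refine ⟨insert_subset (mem_range.2 (by omega)) (hAR.trans (erase_subset _ _)), ?_,
      mem_range.1 (mem_of_mem_erase hxR), ?_, h0A⟩
    · simp only [g]
      rw [card_insert_of_notMem h0A]
      omega
    · simp only [g, mem_insert, not_or]
      exact ⟨ne_of_mem_erase hxR, hxA⟩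
  refine ⟨P.image fun s => pairVec n (g s), ?_, ?_, ?_⟩
  · intro v hv
    obtain ⟨s, hs, rfl⟩ := mem_image.1 hv
    obtain ⟨h1, h2, h3, h4, -⟩ := hP s hs
    exact isPMVec_pairVec h1 h2 h3 h4
  · intro v hv w hw
    obtain ⟨s, hs, rfl⟩ := mem_image.1 hv
    obtain ⟨t, ht, rfl⟩ := mem_image.1 hw
    exact neg_two_lt_dotZ_pairVec (by omega) (hP s hs).2.2.1 (hP t ht).2.2.1 (hP s hs).2.2.2.1
      (hP t ht).2.2.2.1 (mem_insert_self _ _) (mem_insert_self _ _)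
  · rw [card_image_of_injOn, card_sigma, sum_const_nat (m := n - 1 - (k - 1)), card_powersetCard,
      hR, ← Nat.choose_succ_right_eq, Nat.sub_add_cancel hk, mul_comm]
    · intro A hA
      obtain ⟨hAR, hAc⟩ := mem_powersetCard.1 hA
      rw [card_sdiff_of_subset hAR, hR, hAc]
    · rintro s hs t ht h
      obtain ⟨h1, -, h3, h4, h5⟩ := hP s hs
      obtain ⟨h1', -, -, -, h5'⟩ := hP t ht
      have hst := pairVec_inj h1 h3 h4 h1' h
      obtain ⟨A, x⟩ := s
      obtain ⟨B, y⟩ := t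
      simp only [g, Prod.mk.injEq] at hst h5 h5'
      obtain ⟨hAB, rfl⟩ := hst
      rw [← erase_insert h5, hAB, erase_insert h5']

/-- For integers `k ≥ 2` and `n` with `2k ≤ n ≤ k²`, one has `g(n,k,1) = k·C(n-1,k)`. -/
theorem stmt_0 (k n : ℕ) (hk : 2 ≤ k) (hn1 : 2 * k ≤ n) (hn2 : n ≤ k ^ 2) :
    gVal n k 1 = k * Nat.choose (n - 1) k := by
  refine IsGreatest.csSup_eq ⟨?_, ?_⟩
  · simpa using exists_star (n := n) (k := k) (by omega) (by omega)
  · rintro _ ⟨V, hV, hdot, rfl⟩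
    let F : Finset (Finset ℕ × ℕ) := ((range n).powerset ×ˢ range n).filter fun p =>
      #p.1 = k ∧ p.2 ∉ p.1 ∧ pairVec n p ∈ V
    have hmem : ∀ p, p ∈ F ↔ p.1 ⊆ range n ∧ #p.1 = k ∧ p.2 < n ∧ p.2 ∉ p.1 ∧ pairVec n p ∈ V := by
      intro p
      simp only [F, mem_filter, mem_product, mem_powerset, mem_range]
      tauto
    have hF : IsPMPairFamily n k F := fun p hp => by
      obtain ⟨h1, h2, h3, h4, -⟩ := (hmem p).1 hp
      exact ⟨h1, h2, h3, h4⟩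
    have hcf : ConflictFree F := fun p hp q hq h1 h2 h3 => by
      obtain ⟨-, -, hp3, hp4, hpV⟩ := (hmem p).1 hp
      obtain ⟨-, -, hq3, hq4, hqV⟩ := (hmem q).1 hq
      have := hdot _ hpV _ hqV
      rw [dotZ_pairVec_of_conflict hp3 hq3 hp4 hq4 h1 h2 h3] at this
      simp at this
    have hsub : V ⊆ F.image (pairVec n) := fun v hv => by
      obtain ⟨p, h1, h2, h3, h4, rfl⟩ := (hV v hv).exists_pairVec
      exact mem_image.2 ⟨p, (hmem p).2 ⟨h1, h2, h3, h4, hv⟩, rfl⟩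
    exact ((card_le_card hsub).trans card_image_le).trans
      (card_le_of_conflictFree (by omega) n hn1 (by omega) F hF hcf)
end

section
/- For integers k ≥ 2 and n > k², one has g(n+1,k,1) − g(n,k,1) = C(n,k). -/
section PMVec

open Finset

/-- The vector with `+1` on `A` and `-1` at `b` (when `b ∉ A`). -/
def pmVec {n : ℕ} (A : Finset (Fin n)) (b : Fin n) : Fin n → ℤ :=
  fun i => (if i ∈ A then 1 else 0) - (if i = b then 1 else 0)

theorem pmVec_eq_one_iff {n : ℕ} {A : Finset (Fin n)} {b : Fin n} (hb : b ∉ A) (i : Fin n) :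
    pmVec A b i = 1 ↔ i ∈ A := by
  unfold pmVec
  split_ifs with h1 h2 <;> simp_all

theorem pmVec_eq_neg_one_iff {n : ℕ} {A : Finset (Fin n)} {b : Fin n} (hb : b ∉ A) (i : Fin n) :
    pmVec A b i = -1 ↔ i = b := by
  unfold pmVec
  split_ifs with h1 h2 <;> simp_all

theorem isPMVec_pmVec {n : ℕ} {A : Finset (Fin n)} {b : Fin n} (hb : b ∉ A) :
    IsPMVec n A.card 1 (pmVec A b) := by
  refine ⟨fun i => ?_, ?_, ?_⟩
  · unfold pmVec
    split_ifs <;> simp_all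
  · simp [pmVec_eq_one_iff hb]
  · simp [pmVec_eq_neg_one_iff hb, Finset.filter_eq']

theorem IsPMVec.exists_pmVec {n k : ℕ} {v : Fin n → ℤ} (hv : IsPMVec n k 1 v) :
    ∃ A b, b ∉ A ∧ A.card = k ∧ v = pmVec A b := by
  obtain ⟨h, hk, h1⟩ := hv
  obtain ⟨b, hb⟩ := Finset.card_eq_one.1 h1
  have hb' : ∀ i, v i = -1 ↔ i = b := fun i => by
    have := Finset.ext_iff.1 hb i
    simpa using this
  refine ⟨univ.filter fun i => v i = 1, b, ?_, hk, ?_⟩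
  · have := (hb' b).2 rfl
    simp [this]
  · funext i
    have hi := hb' i
    unfold pmVec
    rcases h i with h | h | h <;> simp [h] at hi ⊢ <;> simp [hi]

theorem dotZ_pmVec {n : ℕ} (A B : Finset (Fin n)) (a b : Fin n) :
    dotZ (pmVec A a) (pmVec B b) =
      (A ∩ B).card - (if b ∈ A then 1 else 0) - (if a ∈ B then 1 else 0)
        + (if a = b then 1 else 0) := by
  simp [dotZ, pmVec, mul_sub, Finset.sum_sub_distrib, Finset.inter_comm, eq_comm]
  ring

/-- Families counted by `gVal n k 1`. -/
def Admissible (n k : ℕ) (F : Finset (Fin n → ℤ)) : Prop :=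
  (∀ v ∈ F, IsPMVec n k 1 v) ∧ ∀ v ∈ F, ∀ w ∈ F, -2 < dotZ v w

theorem gVal_set_bddAbove (n k : ℕ) :
    BddAbove {m | ∃ F : Finset (Fin n → ℤ), Admissible n k F ∧ F.card = m} := by
  refine ⟨(univ.image fun p : Finset (Fin n) × Fin n => pmVec p.1 p.2).card, ?_⟩
  rintro m ⟨F, hF, rfl⟩
  refine Finset.card_le_card fun v hv => ?_
  obtain ⟨A, b, -, -, rfl⟩ := (hF.1 v hv).exists_pmVec
  exact mem_image.2 ⟨(A, b), mem_univ _, rfl⟩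

theorem gVal_one_eq (n k : ℕ) :
    gVal n k 1 = sSup {m | ∃ F : Finset (Fin n → ℤ), Admissible n k F ∧ F.card = m} := by
  simp [gVal, Admissible, and_assoc]

theorem Admissible.card_le_gVal {n k : ℕ} {F : Finset (Fin n → ℤ)} (hF : Admissible n k F) :
    F.card ≤ gVal n k 1 := by
  rw [gVal_one_eq]
  exact le_csSup (gVal_set_bddAbove n k) ⟨F, hF, rfl⟩

theorem exists_admissible_card_eq_gVal (n k : ℕ) :
    ∃ F : Finset (Fin n → ℤ), Admissible n k F ∧ F.card = gVal n k 1 := by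
  rw [gVal_one_eq]
  exact Nat.sSup_mem (s := {m | ∃ F : Finset (Fin n → ℤ), Admissible n k F ∧ F.card = m})
    ⟨0, ∅, by simp [Admissible], rfl⟩ (gVal_set_bddAbove n k)

/-- The Erdős–Ko–Rado theorem for subsets of a finset. -/
theorem card_le_of_intersecting_powersetCard {α : Type*} [DecidableEq α] {S : Finset α} {r : ℕ}
    {𝒜 : Finset (Finset α)} (hr : 2 * r ≤ S.card) (hsub : 𝒜 ⊆ S.powersetCard r)
    (hint : ∀ A ∈ 𝒜, ∀ B ∈ 𝒜, ¬ Disjoint A B) :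
    𝒜.card ≤ (S.card - 1).choose (r - 1) := by
  let e := S.equivFin
  let f : Fin S.card ↪ α := e.symm.toEmbedding.trans (Function.Embedding.subtype _)
  let ℬ : Finset (Finset (Fin S.card)) := univ.filter fun B => B.map f ∈ 𝒜
  have hcard : 𝒜.card ≤ ℬ.card := by
    have : 𝒜 ⊆ ℬ.image fun B => B.map f := fun A hA => by
      have hAS := (mem_powersetCard.1 (hsub hA)).1
      have : (univ.filter fun i => f i ∈ A).map f = A := by
        ext x
        simp only [mem_map, mem_filter, mem_univ, true_and]
        constructor
        · rintro ⟨i, hi, rfl⟩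
          exact hi
        · intro hx
          exact ⟨e ⟨x, hAS hx⟩, by simpa [f] using hx, by simp [f]⟩
      exact mem_image.2 ⟨univ.filter fun i => f i ∈ A, by simpa [ℬ, this] using hA, this⟩
    exact (card_le_card this).trans card_image_le
  refine hcard.trans (erdos_ko_rado ?_ ?_ (by omega))
  · intro A hA B hB hAB
    simp only [ℬ, coe_filter, mem_univ, true_and, Set.mem_ofPred_eq] at hA hB
    exact hint _ hA _ hB ((disjoint_map f).2 hAB)
  · intro A hA
    simp only [ℬ, coe_filter, mem_univ, true_and, Set.mem_ofPred_eq] at hA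
    simpa using (mem_powersetCard.1 (hsub hA)).2

theorem card_add_card_le_choose {n k : ℕ} (hk : 2 ≤ k) (hn : k ^ 2 < n)
    {P : Finset (Finset (Fin n) × Fin n)} {N : Finset (Finset (Fin n))}
    (hP : ∀ p ∈ P, p.1.card = k - 1 ∧ p.2 ∉ p.1) (hN : ∀ C ∈ N, C.card = k)
    (hPP : ∀ p ∈ P, ∀ q ∈ P, ¬ Disjoint p.1 q.1)
    (hPN : ∀ p ∈ P, ∀ C ∈ N, p.2 ∈ C → ¬ Disjoint p.1 C) :
    P.card + N.card ≤ n.choose k := by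
  let M := (univ : Finset (Fin n)).powersetCard k \ N
  have hNs : N ⊆ (univ : Finset (Fin n)).powersetCard k := fun C hC =>
    mem_powersetCard.2 ⟨subset_univ _, hN C hC⟩
  have hM : M.card + N.card = n.choose k := by
    rw [card_sdiff_add_card_eq_card hNs, card_powersetCard, card_univ, Fintype.card_fin]
  obtain ⟨r, rfl⟩ : ∃ r, k = r + 2 := ⟨k - 2, by omega⟩
  have hlt : r + 2 < n := by nlinarith
  obtain ⟨m, hm⟩ : ∃ m, n = m + (r + 2) + 1 := ⟨n - (r + 2) - 1, by omega⟩
  have hmr : (r + 2) * (r + 1) ≤ m := by nlinarith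
  have key := card_mul_le_card_mul (fun (p : Finset (Fin n) × Fin n) C => p.2 ∈ C ∧ Disjoint p.1 C)
    (s := P) (t := M) (m := (m + 1).choose (r + 1)) (n := (r + 2) * m.choose r) ?_ ?_
  · have hc := Nat.add_one_mul_choose_eq m r
    have hpos : 0 < m.choose r := Nat.choose_pos (by nlinarith)
    have h1 : P.card * (m + 1) * m.choose r ≤ M.card * ((r + 2) * (r + 1)) * m.choose r := by
      calc P.card * (m + 1) * m.choose r = P.card * (m + 1).choose (r + 1) * (r + 1) := by
            rw [mul_assoc, hc]; ring
        _ ≤ M.card * ((r + 2) * m.choose r) * (r + 1) := Nat.mul_le_mul_right _ key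
        _ = _ := by ring
    have h2 := Nat.le_of_mul_le_mul_right h1 hpos
    have h3 : P.card * (m + 1) ≤ M.card * (m + 1) :=
      h2.trans (Nat.mul_le_mul_left _ (by omega))
    have h4 := Nat.le_of_mul_le_mul_right h3 (Nat.succ_pos m)
    omega
  · intro p hp
    obtain ⟨hp1, hp2⟩ := hP p hp
    have hcard : ((insert p.2 p.1)ᶜ).card = m + 1 := by
      rw [card_compl, Fintype.card_fin, card_insert_of_notMem hp2, hp1]
      omega
    rw [← hcard, ← card_powersetCard]
    refine card_le_card_of_injOn (fun B => insert p.2 B) ?_ ?_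
    · intro B hB
      obtain ⟨hB1, hB2⟩ := mem_powersetCard.1 hB
      have hpB : p.2 ∉ B := fun h => by simpa using hB1 h
      have hd : Disjoint p.1 (insert p.2 B) := by
        rw [disjoint_insert_right]
        refine ⟨hp2, disjoint_left.2 fun x hx hxB => ?_⟩
        have := hB1 hxB
        simp [hx] at this
      refine mem_coe.2 ((mem_bipartiteAbove _).2 ⟨mem_sdiff.2 ⟨mem_powersetCard.2
        ⟨subset_univ _, ?_⟩, fun h => hPN p hp _ h (mem_insert_self _ _) hd⟩,
          mem_insert_self _ _, hd⟩)
      rw [card_insert_of_notMem hpB, hB2]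
    · intro B hB B' hB' h
      have aux : ∀ B ∈ powersetCard (r + 1) (insert p.2 p.1)ᶜ, p.2 ∉ B := fun B hB h => by
        simpa using (mem_powersetCard.1 hB).1 h
      rw [← erase_insert (aux B hB), ← erase_insert (aux B' hB')]
      exact congrArg (fun X => X.erase p.2) h
  · intro C hC
    have hCk : C.card = r + 2 := (mem_powersetCard.1 (mem_sdiff.1 hC).1).2
    let 𝒜 : Finset (Finset (Fin n)) := (P.image Prod.fst).filter fun A => Disjoint A C
    have hcard : (Cᶜ).card = m + 1 := by
      rw [card_compl, Fintype.card_fin, hCk]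
      omega
    have h𝒜 : 𝒜.card ≤ m.choose r := by
      have := card_le_of_intersecting_powersetCard (S := Cᶜ) (r := r + 1) (𝒜 := 𝒜)
        (by rw [hcard]; nlinarith) ?_ ?_
      · simpa [hcard] using this
      · intro A hA
        simp only [𝒜, mem_filter, mem_image] at hA
        obtain ⟨⟨p, hp, rfl⟩, hd⟩ := hA
        refine mem_powersetCard.2 ⟨fun x hx => ?_, by simpa using (hP p hp).1⟩
        exact mem_compl.2 (disjoint_left.1 hd hx)
      · intro A hA B hB
        simp only [𝒜, mem_filter, mem_image] at hA hB
        obtain ⟨⟨p, hp, rfl⟩, -⟩ := hA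
        obtain ⟨⟨q, hq, rfl⟩, -⟩ := hB
        exact hPP p hp q hq
    calc _ ≤ (𝒜 ×ˢ C).card := card_le_card fun p hp => by
            obtain ⟨hp, h1, h2⟩ := (mem_bipartiteBelow _).1 hp
            simp only [𝒜, mem_product, mem_filter, mem_image]
            exact ⟨⟨⟨p, hp, rfl⟩, h2⟩, h1⟩
      _ = 𝒜.card * C.card := card_product _ _
      _ ≤ _ := by rw [hCk, mul_comm]; exact Nat.mul_le_mul_left _ h𝒜

theorem IsPMVec.comp_perm {n k l : ℕ} {v : Fin n → ℤ} (hv : IsPMVec n k l v)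
    (σ : Equiv.Perm (Fin n)) : IsPMVec n k l (v ∘ σ) := by
  obtain ⟨h, hk, hl⟩ := hv
  refine ⟨fun i => h (σ i), ?_, ?_⟩
  · rw [← hk]
    exact card_equiv σ (by simp)
  · rw [← hl]
    exact card_equiv σ (by simp)

theorem dotZ_comm {n : ℕ} (v w : Fin n → ℤ) : dotZ v w = dotZ w v := by
  simp [dotZ, mul_comm]

theorem dotZ_comp_perm {n : ℕ} (v w : Fin n → ℤ) (σ : Equiv.Perm (Fin n)) :
    dotZ (v ∘ σ) (w ∘ σ) = dotZ v w :=
  Equiv.sum_comp σ fun i => v i * w i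

theorem dotZ_comp_swap {n : ℕ} (v w : Fin n → ℤ) {x z : Fin n} (hxz : x ≠ z) :
    dotZ (v ∘ Equiv.swap x z) w = dotZ v w + (v z - v x) * (w x - w z) := by
  have : dotZ (v ∘ Equiv.swap x z) w - dotZ v w =
      ∑ i, (v (Equiv.swap x z i) - v i) * w i := by
    simp [dotZ, sub_mul, Finset.sum_sub_distrib]
  rw [Fintype.sum_eq_add x z hxz] at this
  · simp only [Equiv.swap_apply_left, Equiv.swap_apply_right] at this
    linear_combination this
  · rintro i ⟨h1, h2⟩
    simp [Equiv.swap_apply_of_ne_of_ne h1 h2]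

/-- The shift of the vector `v` relative to the family `F`, moving a larger value from `z`
to `x`. -/
def shiftVec {n : ℕ} (F : Finset (Fin n → ℤ)) (x z : Fin n) (v : Fin n → ℤ) : Fin n → ℤ :=
  if v x < v z ∧ v ∘ Equiv.swap x z ∉ F then v ∘ Equiv.swap x z else v

theorem comp_swap_comp_swap {n : ℕ} (v : Fin n → ℤ) (x z : Fin n) :
    (v ∘ Equiv.swap x z) ∘ Equiv.swap x z = v := by
  funext i
  simp

theorem shiftVec_injOn {n : ℕ} (F : Finset (Fin n → ℤ)) (x z : Fin n) :
    Set.InjOn (shiftVec F x z) F := by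
  intro v hv w hw h
  unfold shiftVec at h
  split_ifs at h with h1 h2 h2
  · rw [← comp_swap_comp_swap v x z, h, comp_swap_comp_swap]
  · exact absurd (h ▸ hw) h1.2
  · exact absurd (h ▸ hv) h2.2
  · exact h

theorem Admissible.image_shiftVec {n k : ℕ} {F : Finset (Fin n → ℤ)} (hF : Admissible n k F)
    {x z : Fin n} (hxz : x ≠ z) : Admissible n k (F.image (shiftVec F x z)) := by
  have aux : ∀ v ∈ F, ∀ w ∈ F, v x < v z → ¬ (w x < w z ∧ w ∘ Equiv.swap x z ∉ F) →
      -2 < dotZ (v ∘ Equiv.swap x z) w := by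
    intro v hv w hw hvx hwx
    by_cases hwF : w ∘ Equiv.swap x z ∈ F
    · rw [← comp_swap_comp_swap w x z, dotZ_comp_perm]
      exact hF.2 v hv _ hwF
    · have hle : w z ≤ w x := not_lt.1 fun h => hwx ⟨h, hwF⟩
      rw [dotZ_comp_swap v w hxz]
      nlinarith [hF.2 v hv w hw]
  constructor
  · intro v hv
    obtain ⟨v, hvF, rfl⟩ := mem_image.1 hv
    unfold shiftVec
    split_ifs
    · exact (hF.1 v hvF).comp_perm _
    · exact hF.1 v hvF
  · intro v hv w hw
    obtain ⟨v, hvF, rfl⟩ := mem_image.1 hv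
    obtain ⟨w, hwF, rfl⟩ := mem_image.1 hw
    unfold shiftVec
    split_ifs with h1 h2 h2
    · rw [dotZ_comp_perm]
      exact hF.2 v hvF w hwF
    · exact aux v hvF w hwF h1.1 h2
    · rw [dotZ_comm]
      exact aux w hwF v hvF h2.1 h1
    · exact hF.2 v hvF w hwF

theorem exists_shifted_admissible (n k : ℕ) (z : Fin n) :
    ∃ F : Finset (Fin n → ℤ), Admissible n k F ∧ F.card = gVal n k 1 ∧
      ∀ v ∈ F, ∀ x, v x < v z → v ∘ Equiv.swap x z ∈ F := by
  let φ : Finset (Fin n → ℤ) → ℕ := fun F => ∑ v ∈ F, (v z + 1).toNat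
  obtain ⟨F, ⟨hF, hcard⟩, hmin⟩ := (measure φ).wf.has_min
    {F | Admissible n k F ∧ F.card = gVal n k 1} (exists_admissible_card_eq_gVal n k)
  refine ⟨F, hF, hcard, fun v hv x hvx => ?_⟩
  by_contra hvF
  have hxz : x ≠ z := by
    rintro rfl
    exact lt_irrefl _ hvx
  refine hmin (F.image (shiftVec F x z)) ⟨hF.image_shiftVec hxz, ?_⟩ ?_
  · rw [card_image_of_injOn (shiftVec_injOn F x z), hcard]
  · change φ _ < φ _
    simp only [φ]
    rw [sum_image (shiftVec_injOn F x z)]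
    refine sum_lt_sum (fun w _ => ?_) ⟨v, hv, ?_⟩
    · unfold shiftVec
      split_ifs with h
      · have := h.1
        simp only [Function.comp_apply, Equiv.swap_apply_right]
        omega
      · exact le_rfl
    · rw [shiftVec, if_pos ⟨hvx, hvF⟩]
      have : -1 ≤ v x := by
        rcases (hF.1 v hv).1 x with h | h | h <;> omega
      simp only [Function.comp_apply, Equiv.swap_apply_right]
      omega

theorem Admissible.not_disjoint {n k : ℕ} {F : Finset (Fin n → ℤ)} (hF : Admissible n k F)
    {A B : Finset (Fin n)} {a b : Fin n} (hA : pmVec A a ∈ F) (hB : pmVec B b ∈ F)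
    (haB : a ∈ B) (hbA : b ∈ A) (hab : a ≠ b) : ¬ Disjoint A B := by
  intro hd
  have := hF.2 _ hA _ hB
  rw [dotZ_pmVec, disjoint_iff_inter_eq_empty.1 hd] at this
  simp [haB, hbA, hab] at this

theorem pmVec_insert_comp_swap {n : ℕ} {A : Finset (Fin n)} {b x z : Fin n} (hzA : z ∉ A)
    (hxA : x ∉ A) (hxb : x ≠ b) (hzb : z ≠ b) :
    pmVec (insert z A) b ∘ Equiv.swap x z = pmVec (insert x A) b := by
  funext i
  by_cases hix : i = x
  · subst hix
    simp [pmVec, hzb, hxb]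
  by_cases hiz : i = z
  · subst hiz
    simp [pmVec, hxA, hzA, hzb, hxb, hix, Ne.symm hix]
  · simp [pmVec, Equiv.swap_apply_of_ne_of_ne hix hiz, hix, hiz]

theorem pmVec_insert_comp_swap_neg {n : ℕ} {A : Finset (Fin n)} {b z : Fin n} (hzA : z ∉ A)
    (hbA : b ∉ A) (hzb : z ≠ b) :
    pmVec (insert z A) b ∘ Equiv.swap b z = pmVec (insert b A) z := by
  funext i
  by_cases hib : i = b
  · subst hib
    simp [pmVec, hzb, hzb.symm]
  by_cases hiz : i = z
  · subst hiz
    simp [pmVec, hbA, hzA, hib, Ne.symm hib]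
  · simp [pmVec, Equiv.swap_apply_of_ne_of_ne hib hiz, hib, hiz]

theorem Admissible.not_disjoint_of_shifted {n k : ℕ} {F : Finset (Fin n → ℤ)}
    (hF : Admissible n k F) {z : Fin n}
    (hsh : ∀ v ∈ F, ∀ x, v x < v z → v ∘ Equiv.swap x z ∈ F)
    {A B : Finset (Fin n)} {a b : Fin n} (hA : pmVec (insert z A) a ∈ F)
    (hB : pmVec (insert z B) b ∈ F) (hzA : z ∉ A) (hzB : z ∉ B) (hza : z ≠ a) (hzb : z ≠ b)
    (haA : a ∉ A) (hbB : b ∉ B) (hn : A.card + B.card + 1 < n) : ¬ Disjoint A B := by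
  intro hd
  have shift : ∀ {A : Finset (Fin n)} {a x : Fin n}, pmVec (insert z A) a ∈ F → z ∉ A → z ≠ a →
      x ∉ A → x ≠ a → pmVec (insert x A) a ∈ F := by
    intro A a x hA hzA hza hxA hxa
    by_cases hxz : x = z
    · rwa [hxz]
    rw [← pmVec_insert_comp_swap hzA hxA hxa hza]
    refine hsh _ hA _ ?_
    simp [pmVec, hxA, hxa, hxz, hza]
  have shift_neg : pmVec (insert a A) z ∈ F := by
    rw [← pmVec_insert_comp_swap_neg hzA haA hza]
    refine hsh _ hA _ ?_
    simp [pmVec, haA, hza, hza.symm]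
  by_cases hab : a = b
  · subst hab
    refine hF.not_disjoint shift_neg hB (mem_insert_self _ _) (mem_insert_self _ _) hza ?_
    simp [disjoint_insert_left, disjoint_insert_right, *]
  have hdr := disjoint_right.1 hd
  have hdl := disjoint_left.1 hd
  by_cases hbA : b ∈ A
  · by_cases haB : a ∈ B
    · obtain ⟨x, hx⟩ : ∃ x, x ∉ insert z (A ∪ B) := by
        by_contra! h
        have h1 := card_le_card (fun x _ => h x : (univ : Finset (Fin n)) ⊆ _)
        have h2 := card_insert_le z (A ∪ B)
        have h3 := card_union_le A B
        rw [card_univ, Fintype.card_fin] at h1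
        omega
      simp only [mem_insert, mem_union, not_or] at hx
      refine hF.not_disjoint hA (shift hB hzB hzb hx.2.2 fun h => hx.2.1 (h ▸ hbA))
        (mem_insert_of_mem haB) (mem_insert_of_mem hbA) hab ?_
      simp [disjoint_insert_left, disjoint_insert_right, *]
    · refine hF.not_disjoint hA (shift hB hzB hzb haB hab)
        (mem_insert_self _ _) (mem_insert_of_mem hbA) hab ?_
      simp [disjoint_insert_left, disjoint_insert_right, *, hza.symm]
  · by_cases haB : a ∈ B
    · refine hF.not_disjoint (shift hA hzA hza hbA (Ne.symm hab)) hB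
        (mem_insert_of_mem haB) (mem_insert_self _ _) hab ?_
      simp [disjoint_insert_left, disjoint_insert_right, *]
    · refine hF.not_disjoint (shift hA hzA hza hbA (Ne.symm hab)) (shift hB hzB hzb haB hab)
        (mem_insert_self _ _) (mem_insert_self _ _) hab ?_
      simp [disjoint_insert_left, disjoint_insert_right, *]

theorem map_castSuccEmb_filter {n : ℕ} (A : Finset (Fin (n + 1))) :
    (univ.filter fun i : Fin n => i.castSucc ∈ A).map Fin.castSuccEmb =
      A.erase (Fin.last n) := by
  ext x
  induction x using Fin.lastCases with
  | last => simp [Fin.castSucc_ne_last]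
  | cast i => simp [Fin.castSucc_ne_last]

theorem pmVec_snoc {n : ℕ} (A : Finset (Fin n)) (a : Fin n) :
    (Fin.snoc (pmVec A a) 0 : Fin (n + 1) → ℤ) = pmVec (A.map Fin.castSuccEmb) a.castSucc := by
  funext i
  induction i using Fin.lastCases with
  | last => simp [pmVec, Fin.castSucc_ne_last, (Fin.castSucc_ne_last _).symm]
  | cast i => simp [pmVec]

theorem last_notMem_map_castSuccEmb {n : ℕ} (A : Finset (Fin n)) :
    Fin.last n ∉ A.map Fin.castSuccEmb := by
  simp [Fin.castSucc_ne_last]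

theorem dotZ_snoc {n : ℕ} (v w : Fin n → ℤ) (x y : ℤ) :
    dotZ (Fin.snoc v x : Fin (n + 1) → ℤ) (Fin.snoc w y) = dotZ v w + x * y := by
  simp [dotZ, Fin.sum_univ_castSucc]

theorem gVal_add_choose_le (n k : ℕ) : gVal n k 1 + n.choose k ≤ gVal (n + 1) k 1 := by
  obtain ⟨F, hF, hcard⟩ := exists_admissible_card_eq_gVal n k
  let F₁ : Finset (Fin (n + 1) → ℤ) := F.image fun v => Fin.snoc v 0
  let F₂ : Finset (Fin (n + 1) → ℤ) := ((univ : Finset (Fin n)).powersetCard k).image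
    fun C => pmVec (C.map Fin.castSuccEmb) (Fin.last n)
  have h₁ : F₁.card = gVal n k 1 := by
    rw [card_image_of_injective, hcard]
    intro v w h
    funext i
    simpa using congrFun h i.castSucc
  have h₂ : F₂.card = n.choose k := by
    rw [card_image_of_injective, card_powersetCard, card_univ, Fintype.card_fin]
    intro C D h
    ext i
    have := pmVec_eq_one_iff (last_notMem_map_castSuccEmb C) i.castSucc
    have h' := congrFun h i.castSucc
    simp only at h'
    rw [h', pmVec_eq_one_iff (last_notMem_map_castSuccEmb D) i.castSucc] at this
    simpa using this.symm
  have hd : Disjoint F₁ F₂ := by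
    rw [disjoint_left]
    intro v hv hv'
    obtain ⟨v, -, rfl⟩ := mem_image.1 hv
    obtain ⟨C, -, h⟩ := mem_image.1 hv'
    have := congrFun h (Fin.last n)
    simp [pmVec, Fin.castSucc_ne_last] at this
  have cross : ∀ v ∈ F₁, ∀ w ∈ F₂, -2 < dotZ v w := by
    intro v hv w hw
    obtain ⟨v, hvF, rfl⟩ := mem_image.1 hv
    obtain ⟨C, -, rfl⟩ := mem_image.1 hw
    obtain ⟨A, a, -, -, rfl⟩ := (hF.1 v hvF).exists_pmVec
    rw [pmVec_snoc, dotZ_pmVec, if_neg (last_notMem_map_castSuccEmb A),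
      if_neg (Fin.castSucc_ne_last a)]
    split_ifs <;> omega
  rw [← h₁, ← h₂, ← card_union_of_disjoint hd]
  refine Admissible.card_le_gVal ⟨fun v hv => ?_, fun v hv w hw => ?_⟩
  · rcases mem_union.1 hv with hv | hv
    · obtain ⟨v, hvF, rfl⟩ := mem_image.1 hv
      obtain ⟨A, a, ha, rfl, rfl⟩ := (hF.1 v hvF).exists_pmVec
      rw [pmVec_snoc, ← card_map Fin.castSuccEmb]
      exact isPMVec_pmVec (by simpa using ha)
    · obtain ⟨C, hC, rfl⟩ := mem_image.1 hv
      rw [← (mem_powersetCard.1 hC).2, ← card_map Fin.castSuccEmb]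
      exact isPMVec_pmVec (last_notMem_map_castSuccEmb C)
  · rcases mem_union.1 hv with hv | hv <;> rcases mem_union.1 hw with hw | hw
    · obtain ⟨v, hvF, rfl⟩ := mem_image.1 hv
      obtain ⟨w, hwF, rfl⟩ := mem_image.1 hw
      rw [dotZ_snoc, mul_zero, add_zero]
      exact hF.2 v hvF w hwF
    · exact cross v hv w hw
    · rw [dotZ_comm]
      exact cross w hw v hv
    · obtain ⟨C, -, rfl⟩ := mem_image.1 hv
      obtain ⟨D, -, rfl⟩ := mem_image.1 hw
      rw [dotZ_pmVec, if_neg (last_notMem_map_castSuccEmb C),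
        if_neg (last_notMem_map_castSuccEmb D), if_pos rfl]
      omega

theorem exists_eq_snoc_pmVec_of_last_eq_zero {n k : ℕ} {w : Fin (n + 1) → ℤ}
    (hw : IsPMVec (n + 1) k 1 w) (h0 : w (Fin.last n) = 0) :
    ∃ A a, a ∉ A ∧ A.card = k ∧ w = (Fin.snoc (pmVec A a) 0 : Fin (n + 1) → ℤ) := by
  obtain ⟨A, a, ha, hk, rfl⟩ := hw.exists_pmVec
  have hA : Fin.last n ∉ A := fun h => by
    rw [(pmVec_eq_one_iff ha _).2 h] at h0
    exact one_ne_zero h0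
  induction a using Fin.lastCases with
  | last => rw [(pmVec_eq_neg_one_iff ha _).2 rfl] at h0; simp at h0
  | cast a =>
    have hmap := map_castSuccEmb_filter A
    rw [erase_eq_of_notMem hA] at hmap
    refine ⟨univ.filter fun i : Fin n => i.castSucc ∈ A, a, by simpa using ha, ?_, ?_⟩
    · rw [← card_map Fin.castSuccEmb, hmap, hk]
    · rw [pmVec_snoc, hmap]

theorem exists_eq_pmVec_map_of_last_eq_neg_one {n k : ℕ} {w : Fin (n + 1) → ℤ}
    (hw : IsPMVec (n + 1) k 1 w) (h0 : w (Fin.last n) = -1) :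
    ∃ A : Finset (Fin n), A.card = k ∧ w = pmVec (A.map Fin.castSuccEmb) (Fin.last n) := by
  obtain ⟨A, a, ha, hk, rfl⟩ := hw.exists_pmVec
  obtain rfl := (pmVec_eq_neg_one_iff ha _).1 h0
  have hmap := map_castSuccEmb_filter A
  rw [erase_eq_of_notMem ha] at hmap
  refine ⟨univ.filter fun i : Fin n => i.castSucc ∈ A, ?_, ?_⟩
  · rw [← card_map Fin.castSuccEmb, hmap, hk]
  · rw [hmap]

theorem exists_eq_pmVec_map_of_last_eq_one {n k : ℕ} {w : Fin (n + 1) → ℤ}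
    (hw : IsPMVec (n + 1) k 1 w) (h0 : w (Fin.last n) = 1) :
    ∃ (A : Finset (Fin n)) (a : Fin n), a ∉ A ∧ A.card = k - 1 ∧
      w = pmVec (insert (Fin.last n) (A.map Fin.castSuccEmb)) a.castSucc := by
  obtain ⟨A, a, ha, hk, rfl⟩ := hw.exists_pmVec
  have hA := (pmVec_eq_one_iff ha _).1 h0
  induction a using Fin.lastCases with
  | last => exact absurd hA ha
  | cast a =>
    have hmap := map_castSuccEmb_filter A
    refine ⟨univ.filter fun i : Fin n => i.castSucc ∈ A, a, by simpa using ha, ?_, ?_⟩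
    · rw [← card_map Fin.castSuccEmb, hmap, card_erase_of_mem hA, hk]
    · rw [hmap, insert_erase hA]

theorem Admissible.card_filter_last_eq_zero_le {n k : ℕ} {F : Finset (Fin (n + 1) → ℤ)}
    (hF : Admissible (n + 1) k F) :
    (F.filter fun v => v (Fin.last n) = 0).card ≤ gVal n k 1 := by
  let F₀ : Finset (Fin n → ℤ) := (F.filter fun v => v (Fin.last n) = 0).image Fin.init
  have hF₀ : ∀ v ∈ F₀, (Fin.snoc v 0 : Fin (n + 1) → ℤ) ∈ F ∧ IsPMVec n k 1 v := by
    intro v hv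
    obtain ⟨w, hw, rfl⟩ := mem_image.1 hv
    obtain ⟨hwF, hw0⟩ := mem_filter.1 hw
    obtain ⟨A, a, ha, rfl, rfl⟩ := exists_eq_snoc_pmVec_of_last_eq_zero (hF.1 w hwF) hw0
    rw [Fin.init_snoc]
    exact ⟨hwF, isPMVec_pmVec ha⟩
  have hcard : F₀.card = (F.filter fun v => v (Fin.last n) = 0).card := by
    refine card_image_of_injOn fun v hv w hw h => ?_
    rw [← Fin.snoc_init_self v, ← Fin.snoc_init_self w, h, (mem_filter.1 hv).2,
      (mem_filter.1 hw).2]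
  rw [← hcard]
  refine Admissible.card_le_gVal ⟨fun v hv => (hF₀ v hv).2, fun v hv w hw => ?_⟩
  simpa [dotZ_snoc] using hF.2 _ (hF₀ v hv).1 _ (hF₀ w hw).1

theorem gVal_succ_le {n k : ℕ} (hk : 2 ≤ k) (hn : k ^ 2 < n) :
    gVal (n + 1) k 1 ≤ gVal n k 1 + n.choose k := by
  obtain ⟨F, hF, hcard, hsh⟩ := exists_shifted_admissible (n + 1) k (Fin.last n)
  let P : Finset (Finset (Fin n) × Fin n) := univ.filter fun p => p.2 ∉ p.1 ∧
    p.1.card = k - 1 ∧ pmVec (insert (Fin.last n) (p.1.map Fin.castSuccEmb)) p.2.castSucc ∈ F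
  let N : Finset (Finset (Fin n)) := univ.filter fun C =>
    C.card = k ∧ pmVec (C.map Fin.castSuccEmb) (Fin.last n) ∈ F
  have hP : (F.filter fun v => v (Fin.last n) = 1).card ≤ P.card := by
    refine (card_le_card fun w hw => ?_).trans (card_image_le (s := P) (f := fun p =>
      pmVec (insert (Fin.last n) (p.1.map Fin.castSuccEmb)) p.2.castSucc))
    obtain ⟨hwF, hw1⟩ := mem_filter.1 hw
    obtain ⟨A, a, ha, hA, rfl⟩ := exists_eq_pmVec_map_of_last_eq_one (hF.1 w hwF) hw1
    exact mem_image.2 ⟨(A, a), mem_filter.2 ⟨mem_univ _, ha, hA, hwF⟩, rfl⟩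
  have hN : (F.filter fun v => v (Fin.last n) = -1).card ≤ N.card := by
    refine (card_le_card fun w hw => ?_).trans (card_image_le (s := N) (f := fun C =>
      pmVec (C.map Fin.castSuccEmb) (Fin.last n)))
    obtain ⟨hwF, hw1⟩ := mem_filter.1 hw
    obtain ⟨A, hA, rfl⟩ := exists_eq_pmVec_map_of_last_eq_neg_one (hF.1 w hwF) hw1
    exact mem_image.2 ⟨A, mem_filter.2 ⟨mem_univ _, hA, hwF⟩, rfl⟩
  have hsplit : F.card ≤ (F.filter fun v => v (Fin.last n) = 0).card +
      ((F.filter fun v => v (Fin.last n) = 1).card +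
        (F.filter fun v => v (Fin.last n) = -1).card) := by
    refine le_trans (card_le_card fun v hv => ?_) ((card_union_le _ _).trans
      (Nat.add_le_add_left (card_union_le _ _) _))
    simpa [hv] using (hF.1 v hv).1 (Fin.last n)
  have hPN : P.card + N.card ≤ n.choose k := by
    refine card_add_card_le_choose hk hn (fun p hp => ?_) (fun C hC => ?_)
      (fun p hp q hq => ?_) fun p hp C hC hpC hd => ?_
    · obtain ⟨-, h1, h2, -⟩ := mem_filter.1 hp
      exact ⟨h2, h1⟩
    · exact (mem_filter.1 hC).2.1
    · obtain ⟨-, hp1, hp2, hp3⟩ := mem_filter.1 hp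
      obtain ⟨-, hq1, hq2, hq3⟩ := mem_filter.1 hq
      rw [← disjoint_map Fin.castSuccEmb]
      refine hF.not_disjoint_of_shifted hsh hp3 hq3 (last_notMem_map_castSuccEmb _)
        (last_notMem_map_castSuccEmb _) (Fin.castSucc_ne_last _).symm
        (Fin.castSucc_ne_last _).symm (by simpa using hp1) (by simpa using hq1) ?_
      rw [card_map, card_map, hp2, hq2]
      have : 2 * k ≤ k ^ 2 := by nlinarith
      omega
    · obtain ⟨-, hp1, -, hp3⟩ := mem_filter.1 hp
      obtain ⟨-, -, hC⟩ := mem_filter.1 hC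
      refine hF.not_disjoint hp3 hC (by simpa using hpC) (mem_insert_self _ _)
        (Fin.castSucc_ne_last _) ?_
      rw [disjoint_insert_left]
      exact ⟨last_notMem_map_castSuccEmb C, (disjoint_map _).2 hd⟩
  have h0 := hF.card_filter_last_eq_zero_le
  omega

end PMVec

/-- For integers `k ≥ 2` and `n > k²`, one has `g(n+1,k,1) - g(n,k,1) = C(n,k)`. -/
theorem stmt_1 (k n : ℕ) (hk : 2 ≤ k) (hn : k ^ 2 < n) :
    gVal (n + 1) k 1 = gVal n k 1 + Nat.choose n k :=
  le_antisymm (gVal_succ_le hk hn) (gVal_add_choose_le n k)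
end

section
/- For integers k > ℓ ≥ 1 and n ≥ 2k, one has g(n,k,ℓ) ≤ C(n,k+ℓ)·C(k+ℓ−1,ℓ−1) + C(n,2ℓ)·C(2ℓ,ℓ)·C(n−2ℓ−1,k−ℓ−1). -/
section

open Finset FinsetFamily

/-- If two families of `r`-subsets of `Fin n` are cross-intersecting and `2 * r ≤ n`, the smaller
one has at most `(n - 1).choose (r - 1)` members. -/
lemma card_le_or_card_le_of_cross_intersecting_fin {n r : ℕ} {𝒜 ℬ : Finset (Finset (Fin n))}
    (hr : 1 ≤ r) (hrn : 2 * r ≤ n) (h𝒜 : (𝒜 : Set (Finset (Fin n))).Sized r)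
    (hℬ : (ℬ : Set (Finset (Fin n))).Sized r) (h : ∀ A ∈ 𝒜, ∀ B ∈ ℬ, ¬ Disjoint A B) :
    #𝒜 ≤ (n - 1).choose (r - 1) ∨ #ℬ ≤ (n - 1).choose (r - 1) := by
  by_contra! ⟨hA, hB⟩
  have hdisj : Disjoint 𝒜 (∂^[n - 2 * r] ℬᶜˢ) := disjoint_right.2 fun A hAbar hA ↦ by
    simp only [mem_shadow_iterate_iff_exists_sdiff, mem_compls] at hAbar
    obtain ⟨C, hC, hAC, _⟩ := hAbar
    exact h A hA _ hC (disjoint_of_subset_left hAC disjoint_compl_right)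
  have hcard : (n - 1).choose (n - r) ≤ #ℬᶜˢ := by
    rw [card_compls, Nat.choose_symm_of_eq_add (by omega : n - 1 = (n - r) + (r - 1))]
    exact hB.le
  have hsized : (ℬᶜˢ : Set (Finset (Fin n))).Sized (n - r) := by simpa using hℬ.compls
  have kk := kruskal_katona_lovasz_form (i := n - 2 * r) (by omega) (by omega)
    (Nat.sub_le n 1) hsized hcard
  have hsub : n - r - (n - 2 * r) = r := by omega
  rw [hsub] at kk
  have hunion : #(𝒜 ∪ ∂^[n - 2 * r] ℬᶜˢ) ≤ n.choose r := by
    have hs : ((𝒜 ∪ ∂^[n - 2 * r] ℬᶜˢ : Finset (Finset (Fin n))) :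
        Set (Finset (Fin n))).Sized r := by
      rw [coe_union, Set.sized_union]
      refine ⟨h𝒜, ?_⟩
      have := hsized.shadow_iterate (k := n - 2 * r)
      rwa [hsub] at this
    simpa using hs.card_le
  rw [card_union_of_disjoint hdisj] at hunion
  have hpascal : n.choose r = (n - 1).choose (r - 1) + (n - 1).choose r := by
    obtain ⟨n, rfl⟩ : ∃ m, n = m + 1 := ⟨n - 1, by omega⟩
    obtain ⟨r, rfl⟩ : ∃ s, r = s + 1 := ⟨r - 1, by omega⟩
    exact Nat.choose_succ_succ _ _
  omega

section

variable {α : Type*} [DecidableEq α]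

/-- If two families of `r`-subsets of `T` are cross-intersecting and `2 * r ≤ #T`, the smaller
one has at most `(#T - 1).choose (r - 1)` members. -/
lemma card_le_or_card_le_of_cross_intersecting {T : Finset α} {r : ℕ} {𝒜 ℬ : Finset (Finset α)}
    (hr : 1 ≤ r) (hrT : 2 * r ≤ #T) (h𝒜 : 𝒜 ⊆ powersetCard r T) (hℬ : ℬ ⊆ powersetCard r T)
    (h : ∀ A ∈ 𝒜, ∀ B ∈ ℬ, ¬ Disjoint A B) :
    #𝒜 ≤ (#T - 1).choose (r - 1) ∨ #ℬ ≤ (#T - 1).choose (r - 1) := by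
  let f : Fin #T ↪ α := T.equivFin.symm.toEmbedding.trans (.subtype _)
  have hf : univ.map f = T := by
    ext x
    simp only [mem_map, mem_univ, true_and]
    refine ⟨?_, fun hx ↦ ⟨T.equivFin ⟨x, hx⟩, by simp [f]⟩⟩
    rintro ⟨i, rfl⟩
    exact (T.equivFin.symm i).2
  let pull : Finset α → Finset (Fin #T) := fun A ↦ univ.filter (f · ∈ A)
  have hpull {A : Finset α} (hA : A ⊆ T) : (pull A).map f = A := by
    ext x
    simp only [pull, mem_map, mem_filter, mem_univ, true_and]
    refine ⟨?_, fun hx ↦ ?_⟩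
    · rintro ⟨i, hi, rfl⟩
      exact hi
    · obtain ⟨i, -, rfl⟩ := mem_map.1 (hf ▸ hA hx)
      exact ⟨i, hx, rfl⟩
  have hcard {𝒞 : Finset (Finset α)} (h𝒞 : 𝒞 ⊆ powersetCard r T) : #(𝒞.image pull) = #𝒞 := by
    refine card_image_of_injOn fun A hA B hB hAB ↦ ?_
    rw [← hpull (mem_powersetCard.1 (h𝒞 hA)).1, ← hpull (mem_powersetCard.1 (h𝒞 hB)).1]
    exact congrArg (map f) hAB
  have hsized {𝒞 : Finset (Finset α)} (h𝒞 : 𝒞 ⊆ powersetCard r T) :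
      (𝒞.image pull : Set (Finset (Fin #T))).Sized r := by
    intro A hA
    obtain ⟨B, hB, rfl⟩ := mem_image.1 (mem_coe.1 hA)
    obtain ⟨hBT, hBr⟩ := mem_powersetCard.1 (h𝒞 hB)
    rw [← card_map f, hpull hBT, hBr]
  rw [← hcard h𝒜, ← hcard hℬ]
  refine card_le_or_card_le_of_cross_intersecting_fin hr hrT (hsized h𝒜) (hsized hℬ) ?_
  simp only [mem_image]
  rintro _ ⟨A, hA, rfl⟩ _ ⟨B, hB, rfl⟩ hAB
  apply h A hA B hB
  rw [← hpull (mem_powersetCard.1 (h𝒜 hA)).1, ← hpull (mem_powersetCard.1 (hℬ hB)).1]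
  exact (disjoint_map f).2 hAB

/-- The pairs `(A, B)` in `𝒱` with prescribed second component `B` whose first component
contains `C`. -/
def pairFiber (𝒱 : Finset (Finset α × Finset α)) (B C : Finset α) :
    Finset (Finset α × Finset α) :=
  𝒱.filter fun p ↦ p.2 = B ∧ C ⊆ p.1

variable [Fintype α] {k l : ℕ} {𝒱 : Finset (Finset α × Finset α)}

/-- In a family of disjoint pairs without antipodal pairs, the fibers over `(B, C)` and `(C, B)`
cannot both be large. -/
lemma card_pairFiber_le_or (hlk : l < k) (hk : 2 * k ≤ Fintype.card α)
    (h𝒱 : ∀ p ∈ 𝒱, #p.1 = k ∧ #p.2 = l ∧ Disjoint p.1 p.2)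
    (hanti : ∀ p ∈ 𝒱, ∀ q ∈ 𝒱, q.2 ⊆ p.1 → p.2 ⊆ q.1 → ¬ Disjoint p.1 q.1)
    {B C : Finset α} (hB : #B = l) (hC : #C = l) (hBC : Disjoint B C) :
    #(pairFiber 𝒱 B C) ≤ (Fintype.card α - 2 * l - 1).choose (k - l - 1) ∨
      #(pairFiber 𝒱 C B) ≤ (Fintype.card α - 2 * l - 1).choose (k - l - 1) := by
  have hT : #((B ∪ C)ᶜ) = Fintype.card α - 2 * l := by
    rw [card_compl, card_union_of_disjoint hBC, hB, hC, two_mul]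
  let link (B C : Finset α) := (pairFiber 𝒱 B C).image fun p ↦ p.1 \ C
  have hcard (B C : Finset α) : #(link B C) = #(pairFiber 𝒱 B C) := by
    refine card_image_of_injOn fun p hp q hq hpq ↦ ?_
    obtain ⟨-, hpB, hpC⟩ := mem_filter.1 hp
    obtain ⟨-, hqB, hqC⟩ := mem_filter.1 hq
    refine Prod.ext ?_ (hpB.trans hqB.symm)
    rw [← sdiff_union_of_subset hpC, ← sdiff_union_of_subset hqC]
    exact congrArg (· ∪ C) hpq
  have hlink {B C : Finset α} (hC : #C = l) : link B C ⊆ powersetCard (k - l) (B ∪ C)ᶜ := by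
    intro A hA
    obtain ⟨p, hp, rfl⟩ := mem_image.1 hA
    obtain ⟨hp𝒱, rfl, hpC⟩ := mem_filter.1 hp
    obtain ⟨hk, -, hd⟩ := h𝒱 p hp𝒱
    rw [mem_powersetCard, card_sdiff_of_subset hpC, hk, hC]
    refine ⟨fun x hx ↦ ?_, rfl⟩
    rw [mem_sdiff] at hx
    simp only [mem_compl, mem_union, not_or]
    exact ⟨disjoint_left.1 hd hx.1, hx.2⟩
  rw [← hcard B C, ← hcard C B, ← hT]
  refine card_le_or_card_le_of_cross_intersecting (by omega) (by omega) (hlink hC)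
    (union_comm C B ▸ hlink hB) ?_
  simp only [link, mem_image]
  rintro _ ⟨p, hp, rfl⟩ _ ⟨q, hq, rfl⟩ hpq
  obtain ⟨hp𝒱, rfl, hpC⟩ := mem_filter.1 hp
  obtain ⟨hq𝒱, rfl, hqB⟩ := mem_filter.1 hq
  refine hanti p hp𝒱 q hq𝒱 hpC hqB (disjoint_left.2 fun x hxp hxq ↦ ?_)
  exact disjoint_left.1 hpq
    (mem_sdiff.2 ⟨hxp, disjoint_left.1 (h𝒱 q hq𝒱).2.2 hxq⟩)
    (mem_sdiff.2 ⟨hxq, disjoint_left.1 (h𝒱 p hp𝒱).2.2 hxp⟩)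

/-- The pairs of `𝒱` lying in some fiber of size at most `N` are few. -/
lemma card_filter_small_pairFiber_le (N : ℕ)
    (h𝒱 : ∀ p ∈ 𝒱, #p.1 = k ∧ #p.2 = l ∧ Disjoint p.1 p.2) :
    #(𝒱.filter fun p ↦ ∃ C ⊆ p.1, #C = l ∧ #(pairFiber 𝒱 p.2 C) ≤ N) ≤
      (Fintype.card α).choose (2 * l) * (2 * l).choose l * N := by
  calc
    _ ≤ #((powersetCard (2 * l) (univ : Finset α)).biUnion fun S ↦ (powersetCard l S).biUnion
          fun B ↦ if #(pairFiber 𝒱 B (S \ B)) ≤ N then pairFiber 𝒱 B (S \ B) else ∅) := by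
      refine card_le_card fun p hp ↦ ?_
      obtain ⟨hp𝒱, C, hCp, hC, hN⟩ := mem_filter.1 hp
      obtain ⟨-, hl, hd⟩ := h𝒱 p hp𝒱
      have hdC : Disjoint p.2 C := disjoint_of_subset_right hCp hd.symm
      simp only [mem_biUnion, mem_powersetCard]
      refine ⟨p.2 ∪ C, ⟨subset_univ _, ?_⟩, p.2, ⟨subset_union_left, hl⟩, ?_⟩
      · rw [card_union_of_disjoint hdC, hl, hC, two_mul]
      · rw [union_sdiff_cancel_left hdC, if_pos hN]
        exact mem_filter.2 ⟨hp𝒱, rfl, hCp⟩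
    _ ≤ #(powersetCard (2 * l) (univ : Finset α)) * ((2 * l).choose l * N) := by
      refine card_biUnion_le_card_mul _ _ _ fun S hS ↦ ?_
      rw [← (mem_powersetCard.1 hS).2, ← card_powersetCard]
      refine card_biUnion_le_card_mul _ _ _ fun B _ ↦ ?_
      split_ifs with h
      · exact h
      · simp
    _ = _ := by rw [card_powersetCard, card_univ, mul_assoc]

/-- If disjoint `B`, `C` never both occur as second components of pairs of `𝒱` with the same
union, then `𝒱` is no larger than the Erdős–Ko–Rado bound on each union allows. -/
lemma card_le_of_intersecting_on_union (hl : 1 ≤ l) (hlk : l ≤ k)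
    (h𝒱 : ∀ p ∈ 𝒱, #p.1 = k ∧ #p.2 = l ∧ Disjoint p.1 p.2)
    (hint : ∀ p ∈ 𝒱, ∀ q ∈ 𝒱, p.1 ∪ p.2 = q.1 ∪ q.2 → ¬ Disjoint p.2 q.2) :
    #𝒱 ≤ (Fintype.card α).choose (k + l) * (k + l - 1).choose (l - 1) := by
  calc
    #𝒱 ≤ #((powersetCard (k + l) (univ : Finset α)).biUnion fun S ↦
        𝒱.filter fun p ↦ p.1 ∪ p.2 = S) := by
      refine card_le_card fun p hp ↦ ?_
      obtain ⟨hpk, hpl, hd⟩ := h𝒱 p hp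
      simp only [mem_biUnion, mem_powersetCard, mem_filter]
      exact ⟨p.1 ∪ p.2, ⟨subset_univ _, by rw [card_union_of_disjoint hd, hpk, hpl]⟩, hp, rfl⟩
    _ ≤ #(powersetCard (k + l) (univ : Finset α)) * (k + l - 1).choose (l - 1) := by
      refine card_biUnion_le_card_mul _ _ _ fun S hS ↦ ?_
      obtain ⟨-, hS⟩ := mem_powersetCard.1 hS
      have hinj : Set.InjOn Prod.snd
          (𝒱.filter fun p ↦ p.1 ∪ p.2 = S : Set (Finset α × Finset α)) := by
        intro p hp q hq hpq
        obtain ⟨hp, hpS⟩ := mem_filter.1 (mem_coe.1 hp)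
        obtain ⟨hq, hqS⟩ := mem_filter.1 (mem_coe.1 hq)
        refine Prod.ext ?_ hpq
        rw [← union_sdiff_cancel_right (h𝒱 p hp).2.2, ← union_sdiff_cancel_right (h𝒱 q hq).2.2,
          hpS, hqS, hpq]
      have hsub : (𝒱.filter fun p ↦ p.1 ∪ p.2 = S).image Prod.snd ⊆ powersetCard l S := by
        intro B hB
        obtain ⟨p, hp, rfl⟩ := mem_image.1 hB
        obtain ⟨hp𝒱, rfl⟩ := mem_filter.1 hp
        exact mem_powersetCard.2 ⟨subset_union_right, (h𝒱 p hp𝒱).2.1⟩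
      rw [← card_image_of_injOn hinj, ← hS]
      refine or_self_iff.1 <|
        card_le_or_card_le_of_cross_intersecting hl (by omega) hsub hsub ?_
      simp only [mem_image, mem_filter]
      rintro _ ⟨p, ⟨hp, hpS⟩, rfl⟩ _ ⟨q, ⟨hq, hqS⟩, rfl⟩
      exact hint p hp q hq (hpS.trans hqS.symm)
    _ = _ := by rw [card_powersetCard, card_univ]

/-- Upper bound for families of pairs of disjoint sets without antipodal pairs. -/
theorem card_le_of_no_antipodal_pairs (hl : 1 ≤ l) (hlk : l < k) (hk : 2 * k ≤ Fintype.card α)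
    (h𝒱 : ∀ p ∈ 𝒱, #p.1 = k ∧ #p.2 = l ∧ Disjoint p.1 p.2)
    (hanti : ∀ p ∈ 𝒱, ∀ q ∈ 𝒱, q.2 ⊆ p.1 → p.2 ⊆ q.1 → ¬ Disjoint p.1 q.1) :
    #𝒱 ≤ (Fintype.card α).choose (k + l) * (k + l - 1).choose (l - 1) +
      (Fintype.card α).choose (2 * l) * (2 * l).choose l *
        (Fintype.card α - 2 * l - 1).choose (k - l - 1) := by
  classical
  set N := (Fintype.card α - 2 * l - 1).choose (k - l - 1)
  rw [← card_filter_add_card_filter_not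
    (fun p : Finset α × Finset α ↦ ∃ C ⊆ p.1, #C = l ∧ #(pairFiber 𝒱 p.2 C) ≤ N), add_comm]
  refine add_le_add (card_le_of_intersecting_on_union hl hlk.le
    (fun p hp ↦ h𝒱 p (mem_filter.1 hp).1) ?_) (card_filter_small_pairFiber_le N h𝒱)
  intro p hp q hq hpq hd
  obtain ⟨hp, hpN⟩ := mem_filter.1 hp
  obtain ⟨hq, hqN⟩ := mem_filter.1 hq
  have hqp : q.2 ⊆ p.1 := hd.symm.left_le_of_le_sup_right (subset_union_right.trans hpq.ge)
  have hpq : p.2 ⊆ q.1 := hd.left_le_of_le_sup_right (subset_union_right.trans hpq.le)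
  rcases card_pairFiber_le_or hlk hk h𝒱 hanti (h𝒱 p hp).2.1 (h𝒱 q hq).2.1 hd with h | h
  · exact hpN ⟨q.2, hqp, (h𝒱 q hq).2.1, h⟩
  · exact hqN ⟨p.2, hpq, (h𝒱 p hp).2.1, h⟩

end

/-- The sets of coordinates where `v` equals `1` and `-1`, respectively. -/
def signSupports {n : ℕ} (v : Fin n → ℤ) : Finset (Fin n) × Finset (Fin n) :=
  (univ.filter fun i ↦ v i = 1, univ.filter fun i ↦ v i = -1)

lemma signSupports_injOn {n k l : ℕ} : Set.InjOn signSupports {v | IsPMVec n k l v} := by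
  intro v hv w hw h
  obtain ⟨h₁, h₂⟩ := Prod.ext_iff.1 h
  funext i
  have h₁ := Finset.ext_iff.1 h₁ i
  have h₂ := Finset.ext_iff.1 h₂ i
  simp only [signSupports, mem_filter, mem_univ, true_and] at h₁ h₂
  have hvi := hv.1 i
  have hwi := hw.1 i
  omega

lemma dotZ_eq_of_antipodal {n k l : ℕ} {v w : Fin n → ℤ} (hv : IsPMVec n k l v)
    (hw : IsPMVec n k l w) (hwv : (signSupports w).2 ⊆ (signSupports v).1)
    (hvw : (signSupports v).2 ⊆ (signSupports w).1)
    (hd : Disjoint (signSupports v).1 (signSupports w).1) : dotZ v w = -2 * l := by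
  have hterm (i : Fin n) :
      v i * w i = -((if v i = -1 then 1 else 0) + (if w i = -1 then 1 else 0)) := by
    have h₁ : i ∈ (signSupports w).2 → i ∈ (signSupports v).1 := fun h ↦ hwv h
    have h₂ : i ∈ (signSupports v).2 → i ∈ (signSupports w).1 := fun h ↦ hvw h
    have h₃ : i ∈ (signSupports v).1 → i ∉ (signSupports w).1 := fun h ↦ disjoint_left.1 hd h
    simp only [signSupports, mem_filter, mem_univ, true_and] at h₁ h₂ h₃
    rcases hv.1 i with h | h | h <;> rcases hw.1 i with h' | h' | h' <;> simp_all
  rw [dotZ, sum_congr rfl fun i _ ↦ hterm i, sum_neg_distrib, sum_add_distrib, sum_boole,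
    sum_boole, hv.2.2, hw.2.2]
  ring


end

/-- For integers `k > l ≥ 1` and `n ≥ 2k`, one has
`g(n,k,l) ≤ C(n,k+l)·C(k+l-1,l-1) + C(n,2l)·C(2l,l)·C(n-2l-1,k-l-1)`. -/
theorem stmt_3 (k l n : ℕ) (hl : 1 ≤ l) (hlk : l < k) (hn : 2 * k ≤ n) :
    gVal n k l ≤ Nat.choose n (k + l) * Nat.choose (k + l - 1) (l - 1) +
      Nat.choose n (2 * l) * Nat.choose (2 * l) l *
        Nat.choose (n - 2 * l - 1) (k - l - 1) := by
  refine csSup_le' ?_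
  rintro _ ⟨F, hF, hdot, rfl⟩
  rw [← Finset.card_image_of_injOn (signSupports_injOn.mono fun v hv ↦ hF v hv)]
  have hbound := card_le_of_no_antipodal_pairs (𝒱 := F.image signSupports) hl hlk
    (by rwa [Fintype.card_fin]) ?_ ?_
  · rwa [Fintype.card_fin] at hbound
  · simp only [Finset.mem_image]
    rintro _ ⟨v, hv, rfl⟩
    refine ⟨(hF v hv).2.1, (hF v hv).2.2, Finset.disjoint_left.2 fun i h₁ h₂ ↦ ?_⟩
    simp only [signSupports, Finset.mem_filter, Finset.mem_univ, true_and] at h₁ h₂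
    omega
  · simp only [Finset.mem_image]
    rintro _ ⟨v, hv, rfl⟩ _ ⟨w, hw, rfl⟩ hwv hvw hd
    exact (hdot v hv w hw).ne' (dotZ_eq_of_antipodal (hF v hv) (hF w hw) hwv hvw hd)
end
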